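/- Suppose f satisfies (R1) and (R2). Then L = K(π) contains a Galois extension of K of degree p if and only if −F_p/F_{p²} ∈ (κ_K^×)^{p−1}. -/

import Mathlib

open Polynomial IntermediateField

/-- The composite algebra structure `ℤ_[p] → ℚ_[p] → K`. -/
noncomputable instance zpAlgebra (p : ℕ) [Fact (Nat.Prime p)] (K : Type) [Field K]
    [Algebra ℚ_[p] K] : Algebra ℤ_[p] K :=
  ((algebraMap ℚ_[p] K).comp (algebraMap ℤ_[p] ℚ_[p])).toAlgebra

open scoped NNReal

namespace Valuation

section Powers

variable {M : Type*} [Field M] (v : Valuation M ℝ≥0)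

theorem map_natCast_le_one (n : ℕ) : v (n : M) ≤ 1 := by
  induction n with
  | zero => simp
  | succ n ih => rw [Nat.cast_succ]; exact v.map_add_le ih v.map_one.le

theorem map_pow_sub_pow_le {x y : M} {s : ℝ≥0} (hx : v x ≤ s) (hy : v y ≤ s) (n : ℕ) :
    v (x ^ (n + 1) - y ^ (n + 1)) ≤ s ^ n * v (x - y) := by
  rw [← (Commute.all x y).geom_sum₂_mul, map_mul]
  gcongr
  refine v.map_sum_le fun i hi => ?_
  have hi' : i ≤ n := Nat.lt_succ_iff.mp (Finset.mem_range.mp hi)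
  rw [map_mul, map_pow, map_pow]
  calc v x ^ i * v y ^ (n + 1 - 1 - i) ≤ s ^ i * s ^ (n + 1 - 1 - i) := by gcongr
    _ = s ^ n := by rw [← pow_add]; congr 1; omega

/-- Freshman's dream, with error term, for a difference of `p`-th powers. -/
theorem map_prime_pow_sub_le {p : ℕ} (hp : p.Prime) (hodd : Odd p) {x y : M} {s : ℝ≥0}
    (hx : v x ≤ s) (hy : v y ≤ s) :
    v (y ^ p - x ^ p + (x - y) ^ p) ≤ v (p : M) * s ^ (p - 1) * v (x - y) := by
  have key := add_pow_prime_eq hp x (y - x)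
  rw [add_sub_cancel] at key
  have hyx : v (y - x) ≤ s := v.map_sub_le hy hx
  have hsum : v (∑ k ∈ Finset.Ioo 0 p,
      x ^ (k - 1) * (y - x) ^ (p - k - 1) * ((p.choose k / p : ℕ) : M)) ≤ s ^ (p - 2) := by
    refine v.map_sum_le fun k hk => ?_
    obtain ⟨hk0, hkp⟩ := Finset.mem_Ioo.mp hk
    rw [map_mul, map_mul, map_pow, map_pow]
    calc _ ≤ s ^ (k - 1) * s ^ (p - k - 1) * 1 := by
          gcongr
          exact v.map_natCast_le_one _
      _ = s ^ (p - 2) := by rw [mul_one, ← pow_add]; congr 1; omega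
  have heq : y ^ p - x ^ p + (x - y) ^ p = p * x * (y - x) * ∑ k ∈ Finset.Ioo 0 p,
      x ^ (k - 1) * (y - x) ^ (p - k - 1) * ((p.choose k / p : ℕ) : M) := by
    rw [← neg_sub y x, hodd.neg_pow]
    linear_combination key
  rw [heq, map_mul, map_mul, map_mul, v.map_sub_swap x y]
  calc _ ≤ v (p : M) * s * v (y - x) * s ^ (p - 2) := by gcongr
    _ = v (p : M) * (s ^ (p - 2) * s) * v (y - x) := by ring
    _ = _ := by rw [← pow_succ]; congr 3; have := hp.two_le; omega

end Powers

end Valuation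

/-- The valuations of the coefficients `q i` (`1 ≤ i ≤ p ^ 2`) of an Eisenstein polynomial of
degree `p ^ 2`, divided by `p`, under the conditions on ramification considered here; `r` is the
valuation of a root of the polynomial. -/
structure IsReducedCoeffs {M : Type*} [Field M] (v : Valuation M ℝ≥0) (p : ℕ) (r : ℝ≥0)
    (q : ℕ → M) : Prop where
  pos : 0 < r
  lt_one : r < 1
  map_p : v (p : M) = r ^ ((p : ℤ) ^ 2)
  top : v (q (p ^ 2)) = 1
  mid : v (q p) = 1
  mult : ∀ k, 2 ≤ k → k < p → v (q (p * k)) ≤ r ^ ((p : ℤ) ^ 2)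
  low : ∀ i, ¬ p ∣ i → i ≤ p + 1 → v (q i) ≤ r ^ ((p : ℤ) ^ 2)
  high : ∀ i, ¬ p ∣ i → p + 2 ≤ i → i < p ^ 2 → v (q i) ≤ r ^ (2 * (p : ℤ) ^ 2)

namespace IsReducedCoeffs

variable {M : Type*} [Field M] {v : Valuation M ℝ≥0} {p : ℕ} {r : ℝ≥0} {q : ℕ → M}

theorem zpow_le (h : IsReducedCoeffs v p r q) {m n : ℤ} (hmn : m ≤ n) : r ^ n ≤ r ^ m :=
  zpow_le_zpow_right_of_le_one₀ h.pos h.lt_one.le hmn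

theorem zpow_lt (h : IsReducedCoeffs v p r q) {m n : ℤ} (hmn : m < n) : r ^ n < r ^ m :=
  zpow_lt_zpow_right_of_lt_one₀ h.pos h.lt_one hmn

theorem zpow_le_iff (h : IsReducedCoeffs v p r q) {m n : ℤ} : r ^ n ≤ r ^ m ↔ m ≤ n :=
  ⟨fun H => by by_contra hc; exact absurd (h.zpow_lt (not_le.mp hc)) (not_lt.mpr H), h.zpow_le⟩

/-- The difference of the values of the polynomial at two points of valuation `r⁻¹` is governed
by the coefficients of index `p` and `p ^ 2`. -/
theorem map_sum_add_le (h : IsReducedCoeffs v p r q) (hp : p.Prime) (hodd : Odd p) {x y : M}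
    (hx : v x = r ^ (-1 : ℤ)) (hy : v y = r ^ (-1 : ℤ)) :
    v (∑ i ∈ Finset.Icc 1 (p ^ 2), q i * (y ^ i - x ^ i) +
      (q (p ^ 2) * (x ^ p - y ^ p) ^ p + q p * (x ^ p - y ^ p))) ≤
      max (r ^ (p : ℤ) * v (x ^ p - y ^ p)) (r ^ ((p : ℤ) ^ 2 - p) * v (x - y)) := by
  have hp2 := hp.two_le
  have hr0 : r ≠ 0 := h.pos.ne'
  have hpp : p < p ^ 2 := by nlinarith
  set e := x ^ p - y ^ p with he
  have hxp : v (x ^ p) = r ^ (-(p : ℤ)) := by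
    rw [map_pow, hx, ← zpow_natCast, ← zpow_mul]; congr 1; ring
  have hyp : v (y ^ p) = r ^ (-(p : ℤ)) := by
    rw [map_pow, hy, ← zpow_natCast, ← zpow_mul]; congr 1; ring
  have hsplit : q (p ^ 2) * e ^ p + q p * e = ∑ i ∈ Finset.Icc 1 (p ^ 2),
      ((if i = p ^ 2 then q (p ^ 2) * e ^ p else 0) + (if i = p then q p * e else 0)) := by
    rw [Finset.sum_add_distrib, Finset.sum_ite_eq' , Finset.sum_ite_eq', if_pos, if_pos]
    · simp only [Finset.mem_Icc]; omega
    · simp only [Finset.mem_Icc]; omega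
  rw [hsplit, ← Finset.sum_add_distrib]
  refine v.map_sum_le fun i hi => ?_
  obtain ⟨hi1, hi2⟩ := Finset.mem_Icc.mp hi
  have hcop {a : ℤ} (hqi : v (q i) ≤ r ^ a) (ha : (p : ℤ) ^ 2 - p ≤ a + 1 - i) :
      v (q i * (y ^ i - x ^ i)) ≤ r ^ ((p : ℤ) ^ 2 - p) * v (x - y) := by
    obtain ⟨m, rfl⟩ : ∃ m, i = m + 1 := ⟨i - 1, by omega⟩
    rw [map_mul, v.map_sub_swap x y]
    calc _ ≤ r ^ a * ((r ^ (-1 : ℤ)) ^ m * v (y - x)) := by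
          gcongr; exact v.map_pow_sub_pow_le hy.le hx.le m
      _ = r ^ (a - m) * v (y - x) := by
          rw [← mul_assoc, ← zpow_natCast, ← zpow_mul, ← zpow_add₀ hr0]; congr 2; ring
      _ ≤ _ := by
          refine mul_le_mul_left (h.zpow_le ?_) _
          push_cast at ha; linarith
  by_cases hdvd : p ∣ i
  · obtain ⟨k, rfl⟩ := hdvd
    have hk1 : 1 ≤ k := Nat.one_le_iff_ne_zero.mpr (by rintro rfl; omega)
    have hkp : k ≤ p := by rw [sq] at hi2; exact Nat.le_of_mul_le_mul_left hi2 hp.pos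
    apply le_max_of_le_left
    rcases hkp.lt_or_eq with hkp | hkp
    · rw [if_neg (by rw [sq]; intro H; exact hkp.ne (Nat.eq_of_mul_eq_mul_left hp.pos H)), zero_add]
      rcases hk1.lt_or_eq with hk1 | rfl
      · rw [if_neg (by intro H; nlinarith), add_zero]
        obtain ⟨m, rfl⟩ : ∃ m, k = m + 1 := ⟨k - 1, by omega⟩
        rw [map_mul, pow_mul, pow_mul]
        calc _ ≤ r ^ ((p : ℤ) ^ 2) * ((r ^ (-(p : ℤ))) ^ m * v (y ^ p - x ^ p)) := by
              gcongr
              · exact h.mult _ hk1 hkp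
              · exact v.map_pow_sub_pow_le hyp.le hxp.le m
          _ = r ^ ((p : ℤ) ^ 2 - p * m) * v e := by
              rw [he, v.map_sub_swap (x ^ p), ← mul_assoc, ← zpow_natCast, ← zpow_mul,
                ← zpow_add₀ hr0]; congr 2; ring
          _ ≤ _ := by
              refine mul_le_mul_left (h.zpow_le ?_) _
              have : (m : ℤ) + 1 < p := by exact_mod_cast hkp
              nlinarith
      · rw [mul_one, if_pos rfl, ← mul_add, he, sub_add_sub_cancel', sub_self, mul_zero, map_zero]
        exact zero_le
    · rw [hkp, ← sq, if_neg hpp.ne', if_pos rfl, add_zero, ← mul_add,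
        map_mul, h.top, one_mul, sq, pow_mul, pow_mul]
      calc _ ≤ v (p : M) * (r ^ (-(p : ℤ))) ^ (p - 1) * v e :=
            v.map_prime_pow_sub_le hp hodd hxp.le hyp.le
        _ = _ := by
            rw [h.map_p, ← zpow_natCast, ← zpow_mul, ← zpow_add₀ hr0]
            congr 2
            push_cast [hp.one_le]; ring
  · rw [if_neg (by rintro rfl; exact hdvd (dvd_pow_self p two_ne_zero)),
      if_neg (by rintro rfl; exact hdvd dvd_rfl), add_zero, add_zero]
    apply le_max_of_le_right
    rcases Nat.lt_or_ge (p + 1) i with hlt | hge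
    · refine hcop (h.high i hdvd hlt (lt_of_le_of_ne hi2 ?_)) ?_
      · rintro rfl; exact hdvd (dvd_pow_self p two_ne_zero)
      · have : (i : ℤ) ≤ p ^ 2 := by exact_mod_cast hi2
        linarith [(Nat.cast_nonneg p : (0 : ℤ) ≤ p)]
    · refine hcop (h.low i hdvd hge) ?_
      have : (i : ℤ) ≤ p + 1 := by exact_mod_cast hge
      linarith

end IsReducedCoeffs

namespace IsReducedCoeffs

variable {M : Type*} [Field M] {v : Valuation M ℝ≥0} {p : ℕ} {r : ℝ≥0} {q : ℕ → M}

theorem map_p_lt_one (h : IsReducedCoeffs v p r q) (hp : p.Prime) : v (p : M) < 1 := by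
  rw [h.map_p, ← zpow_zero r]
  exact h.zpow_lt (by have := hp.pos; positivity)

theorem map_natCast_eq_one (h : IsReducedCoeffs v p r q) (hp : p.Prime) {n : ℕ} (hn : ¬ p ∣ n) :
    v (n : M) = 1 := by
  refine le_antisymm (v.map_natCast_le_one n) (not_lt.mp fun hlt => ?_)
  have hcop : IsCoprime (n : ℤ) (p : ℤ) :=
    Nat.isCoprime_iff_coprime.mpr ((hp.coprime_iff_not_dvd.mpr hn).symm)
  obtain ⟨a, b, hab⟩ := hcop
  have hInt (m : ℤ) : v (m : M) ≤ 1 := by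
    rcases m.eq_nat_or_neg with ⟨k, rfl | rfl⟩ <;> simpa using v.map_natCast_le_one k
  have h1 : (1 : M) = a * n + b * p := by
    have := congrArg (Int.cast : ℤ → M) hab
    push_cast at this
    exact this.symm
  have h2 : v (1 : M) < 1 := by
    rw [h1]
    refine v.map_add_lt ?_ ?_
    · rw [map_mul]; exact mul_lt_one_of_nonneg_of_lt_one_right (hInt a) zero_le hlt
    · rw [map_mul]
      exact mul_lt_one_of_nonneg_of_lt_one_right (hInt b) zero_le (h.map_p_lt_one hp)
  simp at h2

theorem map_add_lt_one_of_map_sub_lt_one (h : IsReducedCoeffs v p r q) (hp : p.Prime) {c e : M}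
    (hec : v (e - c) < 1) (hc : v c ≤ 1) (hcr : v (q (p ^ 2) * c ^ p + q p * c) < 1) :
    v (q (p ^ 2) * e ^ p + q p * e) < 1 := by
  have he : v e ≤ 1 := by
    rw [← sub_add_cancel e c]; exact v.map_add_le hec.le hc
  have hpow : v (e ^ p - c ^ p) < 1 := by
    obtain ⟨m, rfl⟩ : ∃ m, p = m + 1 := ⟨p - 1, by have := hp.pos; omega⟩
    refine (v.map_pow_sub_pow_le he hc m).trans_lt ?_
    simpa using hec
  have heq : q (p ^ 2) * e ^ p + q p * e =
      q (p ^ 2) * (e ^ p - c ^ p) + q p * (e - c) + (q (p ^ 2) * c ^ p + q p * c) := by ring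
  rw [heq]
  refine v.map_add_lt (v.map_add_lt ?_ ?_) hcr
  · rwa [map_mul, h.top, one_mul]
  · rwa [map_mul, h.mid, one_mul]

variable {x y : M}

theorem map_pow_sub_sub_pow_le (h : IsReducedCoeffs v p r q) (hp : p.Prime) (hodd : Odd p)
    (hx : v x = r ^ (-1 : ℤ)) (hy : v y = r ^ (-1 : ℤ)) :
    v (x ^ p - y ^ p - (x - y) ^ p) ≤ r ^ ((p : ℤ) ^ 2 - p + 1) * v (x - y) := by
  have h1 := v.map_prime_pow_sub_le hp hodd hx.le hy.le
  rw [h.map_p, ← zpow_natCast (r ^ (-1 : ℤ)), ← zpow_mul, ← zpow_add₀ h.pos.ne'] at h1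
  rw [← v.map_neg]
  convert h1 using 2
  · ring
  · push_cast [hp.one_le]; ring_nf

theorem two_mul_add_one_le_sq (hp : p.Prime) (hodd : Odd p) : 2 * (p : ℤ) + 1 ≤ (p : ℤ) ^ 2 := by
  have h3 : 3 ≤ p := by
    have := hp.two_le
    rcases hodd with ⟨k, rfl⟩; omega
  have : (3 : ℤ) ≤ p := by exact_mod_cast h3
  nlinarith

/-- If `x⁻¹` and `y⁻¹` are roots of the polynomial, then `x - y` and `x ^ p - y ^ p` are integral
and the latter satisfies the residual polynomial. -/
theorem map_sub_le_one (h : IsReducedCoeffs v p r q) (hp : p.Prime) (hodd : Odd p)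
    (hx : v x = r ^ (-1 : ℤ)) (hy : v y = r ^ (-1 : ℤ))
    (hroot : ∑ i ∈ Finset.Icc 1 (p ^ 2), q i * (y ^ i - x ^ i) = 0) :
    v (x ^ p - y ^ p) ≤ 1 ∧ v (x - y) ≤ 1 ∧
      v (q (p ^ 2) * (x ^ p - y ^ p) ^ p + q p * (x ^ p - y ^ p)) < 1 := by
  have hpZ : (0 : ℤ) < p := by exact_mod_cast hp.pos
  have hsq := two_mul_add_one_le_sq hp hodd
  have key := h.map_sum_add_le hp hodd hx hy
  rw [hroot, zero_add] at key
  have hw : v (x - y) ≤ r ^ (-1 : ℤ) := v.map_sub_le hx.le hy.le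
  have hpow := h.map_pow_sub_sub_pow_le hp hodd hx hy
  set e := x ^ p - y ^ p with he
  set w := x - y with hwdef
  have hsmall : r ^ ((p : ℤ) ^ 2 - p) * v w < 1 := by
    calc _ ≤ r ^ ((p : ℤ) ^ 2 - p) * r ^ (-1 : ℤ) := by gcongr
      _ = r ^ ((p : ℤ) ^ 2 - p - 1) := by rw [← zpow_add₀ h.pos.ne']; rfl
      _ < r ^ (0 : ℤ) := h.zpow_lt (by linarith)
      _ = 1 := zpow_zero r
  have hrp : r ^ (p : ℤ) < 1 := by rw [← zpow_zero r]; exact h.zpow_lt hpZ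
  have he1 : v e ≤ 1 := by
    by_contra! hgt
    have hlt : v e < v e ^ p := lt_self_pow₀ hgt hp.one_lt
    have hT : v (q (p ^ 2) * e ^ p + q p * e) = v e ^ p := by
      rw [v.map_add_eq_of_lt_left, map_mul, h.top, one_mul, map_pow]
      rwa [map_mul, map_mul, h.top, h.mid, one_mul, one_mul, map_pow]
    rw [hT] at key
    rcases le_max_iff.mp key with hk | hk
    · exact absurd (hlt.trans_le hk) (not_lt.mpr (mul_le_of_le_one_left zero_le hrp.le))
    · exact absurd ((hgt.trans hlt).trans_le (hk.trans hsmall.le)) (lt_irrefl _)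
  refine ⟨he1, ?_, key.trans_lt (max_lt ?_ hsmall)⟩
  · have hwp : v w ^ p ≤ 1 := by
      rw [← map_pow, ← sub_sub_cancel e (w ^ p)]
      refine v.map_sub_le he1 (hpow.trans (le_trans ?_ hsmall.le))
      exact mul_le_mul_left (h.zpow_le (by linarith)) _
    exact (pow_le_one_iff_of_nonneg zero_le hp.ne_zero).mp hwp
  · exact mul_lt_one_of_nonneg_of_lt_one_left zero_le hrp he1

/-- If `x⁻¹` and `y⁻¹` are roots in the same block, then they are very close to each other. -/
theorem map_sub_le_of_lt (h : IsReducedCoeffs v p r q) (hp : p.Prime) (hodd : Odd p)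
    (hx : v x = r ^ (-1 : ℤ)) (hy : v y = r ^ (-1 : ℤ))
    (hroot : ∑ i ∈ Finset.Icc 1 (p ^ 2), q i * (y ^ i - x ^ i) = 0)
    (hlt : v (x ^ p - y ^ p) < 1) : v (x - y) ≤ r ^ (p : ℤ) := by
  have hpZ : (0 : ℤ) < p := by exact_mod_cast hp.pos
  have hsq := two_mul_add_one_le_sq hp hodd
  have key := h.map_sum_add_le hp hodd hx hy
  rw [hroot, zero_add] at key
  have hpow := h.map_pow_sub_sub_pow_le hp hodd hx hy
  set e := x ^ p - y ^ p with he
  set w := x - y with hwdef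
  have hrp : r ^ (p : ℤ) < 1 := by rw [← zpow_zero r]; exact h.zpow_lt hpZ
  have hele : v e ≤ r ^ ((p : ℤ) ^ 2 - p) * v w := by
    by_contra! hgt
    have he0 : 0 < v e := zero_le.trans_lt hgt
    have h1 : v (q p * e) < v e := by
      rw [← add_sub_cancel_left (q (p ^ 2) * e ^ p) (q p * e)]
      refine v.map_sub_lt (key.trans_lt (max_lt ?_ hgt)) ?_
      · exact mul_lt_of_lt_one_left he0 hrp
      · rw [map_mul, h.top, one_mul, map_pow]
        exact pow_lt_self_of_lt_one₀ he0 hlt hp.one_lt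
    rw [map_mul, h.mid, one_mul] at h1
    exact lt_irrefl _ h1
  rcases eq_or_ne (v w) 0 with hw0 | hw0
  · rw [hw0]; exact zero_le
  have hwp : v w ^ p ≤ r ^ ((p : ℤ) ^ 2 - p) * v w := by
    rw [← map_pow, ← sub_sub_cancel e (w ^ p)]
    refine v.map_sub_le hele (hpow.trans ?_)
    exact mul_le_mul_left (h.zpow_le (by linarith)) _
  obtain ⟨m, hm⟩ : ∃ m, p = m + 1 := ⟨p - 1, by have := hp.pos; omega⟩
  have hm0 : m ≠ 0 := by have := hp.two_le; omega
  have h2 : v w ^ m ≤ (r ^ (p : ℤ)) ^ m := by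
    rw [← zpow_natCast (r ^ (p : ℤ)), ← zpow_mul]
    have h3 : v w ^ p = v w ^ m * v w := by rw [hm, pow_succ]
    rw [h3] at hwp
    convert le_of_mul_le_mul_right hwp (pos_iff_ne_zero.mpr hw0) using 2
    have : (p : ℤ) = m + 1 := by exact_mod_cast hm
    rw [this]; ring
  exact (pow_le_pow_iff_left₀ zero_le zero_le hm0).mp h2

/-- The difference of two `s`-th powers, for `s` prime to `p`. -/
theorem map_pow_sub_pow_eq (h : IsReducedCoeffs v p r q) (hp : p.Prime)
    (hx : v x = r ^ (-1 : ℤ)) (hy : v y = r ^ (-1 : ℤ)) (hxy : v (x - y) = 1) {s : ℕ}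
    (hs : ¬ p ∣ s) : v (y ^ s - x ^ s) = r ^ (1 - (s : ℤ)) := by
  obtain ⟨n, rfl⟩ : ∃ n, s = n + 1 := ⟨s - 1, by
    have : s ≠ 0 := by rintro rfl; exact hs (dvd_zero p)
    omega⟩
  have hr0 := h.pos.ne'
  have hlead : v (((n + 1 : ℕ) : M) * x ^ n) = r ^ (-(n : ℤ)) := by
    rw [map_mul, h.map_natCast_eq_one hp hs, one_mul, map_pow, hx, ← zpow_natCast, ← zpow_mul]
    congr 1; ring
  have herr : v (∑ i ∈ Finset.range (n + 1), (y ^ i - x ^ i) * x ^ (n - i)) < r ^ (-(n : ℤ)) := by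
    refine v.map_sum_lt (zpow_ne_zero _ hr0) fun i hi => ?_
    have hi' : i ≤ n := Nat.lt_succ_iff.mp (Finset.mem_range.mp hi)
    rcases i with _ | i
    · simpa using pow_pos h.pos n
    · rw [map_mul, map_pow, hx]
      calc _ ≤ (r ^ (-1 : ℤ)) ^ i * v (y - x) * (r ^ (-1 : ℤ)) ^ (n - (i + 1)) := by
            gcongr; exact v.map_pow_sub_pow_le hy.le hx.le i
        _ = r ^ (-(n : ℤ) + 1) := by
            rw [v.map_sub_swap, hxy, mul_one, ← pow_add, ← zpow_natCast, ← zpow_mul]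
            congr 1
            have : i + (n - (i + 1)) + 1 = n := by omega
            have : ((i + (n - (i + 1)) : ℕ) : ℤ) + 1 = n := by exact_mod_cast this
            linarith
        _ < _ := h.zpow_lt (by linarith)
  have hsum : y ^ (n + 1) - x ^ (n + 1) = (y - x) * (((n + 1 : ℕ) : M) * x ^ n +
      ∑ i ∈ Finset.range (n + 1), (y ^ i - x ^ i) * x ^ (n - i)) := by
    rw [← (Commute.all y x).mul_geom_sum₂]
    congr 1
    simp only [sub_mul, Finset.sum_sub_distrib, Nat.add_sub_cancel]
    have : ∑ i ∈ Finset.range (n + 1), x ^ i * x ^ (n - i) = ((n + 1 : ℕ) : M) * x ^ n := by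
      rw [Finset.sum_congr rfl fun i hi => by
        rw [← pow_add, Nat.add_sub_cancel' (Nat.lt_succ_iff.mp (Finset.mem_range.mp hi))]]
      simp
    rw [this]; ring
  rw [hsum, map_mul, v.map_sub_swap, hxy, one_mul, v.map_add_eq_of_lt_left (by rwa [hlead]), hlead]
  congr 1; push_cast; ring

end IsReducedCoeffs

/-- If the values of `K` are powers of `v π ^ N`, then the value of a `K`-linear combination of
`1, π, …, π ^ (N - 1)` is the maximum of the values of its terms. -/
theorem Valuation.exists_map_sum_eq {K M : Type*} [Field K] [Field M] [Algebra K M]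
    (v : Valuation M ℝ≥0) {r : ℝ≥0} (hr0 : 0 < r) (hr1 : r < 1) {N : ℕ} (hN : 0 < N) {π : M}
    (hπ : v π = r)
    (hK : ∀ c : K, c ≠ 0 → ∃ n : ℤ, v (algebraMap K M c) = r ^ ((N : ℤ) * n)) (c : ℕ → K) :
    ∃ i₀ < N, v (∑ i ∈ Finset.range N, algebraMap K M (c i) * π ^ i) =
      v (algebraMap K M (c i₀) * π ^ i₀) ∧
      ∀ i < N, v (algebraMap K M (c i) * π ^ i) ≤ v (algebraMap K M (c i₀) * π ^ i₀) := by
  obtain ⟨i₀, hi₀, hmax⟩ := Finset.exists_max_image (Finset.range N)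
    (fun i => v (algebraMap K M (c i) * π ^ i)) ⟨0, by simpa using hN⟩
  refine ⟨i₀, by simpa using hi₀, ?_, fun i hi => hmax i (by simpa using hi)⟩
  by_cases hc : c i₀ = 0
  · have hall : ∀ i ∈ Finset.range N, algebraMap K M (c i) * π ^ i = 0 := fun i hi => by
      have := hmax i hi
      simp only [hc, map_zero, zero_mul] at this
      exact (map_eq_zero v).mp (le_antisymm this zero_le)
    rw [Finset.sum_eq_zero hall, hc]; simp
  · refine v.map_sum_eq_of_lt hi₀ fun i hi => ?_
    obtain ⟨hi, hne⟩ := Finset.mem_sdiff.mp hi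
    simp only [Finset.mem_singleton] at hne
    refine lt_of_le_of_ne (hmax i hi) fun heq => hne ?_
    by_cases hci : c i = 0
    · exfalso
      rw [hci, map_zero, zero_mul, map_zero, eq_comm, map_eq_zero] at heq
      have hπ0 : π ≠ 0 := by rintro rfl; rw [map_zero] at hπ; exact hr0.ne hπ
      simp [hc, hπ0] at heq
    · obtain ⟨m, hm⟩ := hK _ hci
      obtain ⟨n, hn⟩ := hK _ hc
      rw [map_mul, map_mul, map_pow, map_pow, hm, hn, hπ, ← zpow_natCast, ← zpow_natCast,
        ← zpow_add₀ hr0.ne', ← zpow_add₀ hr0.ne'] at heq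
      have := zpow_right_injective₀ hr0 hr1.ne heq
      have hmod : (i : ℤ) ≡ i₀ [ZMOD N] := by
        rw [Int.modEq_iff_dvd]
        exact ⟨m - n, by linarith⟩
      have := (Int.natCast_modEq_iff.mp hmod)
      rwa [Nat.ModEq, Nat.mod_eq_of_lt (Finset.mem_range.mp hi),
        Nat.mod_eq_of_lt (Finset.mem_range.mp hi₀)] at this

/-- `π` is a root of an Eisenstein polynomial over `K` of degree `p ^ 2` whose coefficients are
`p * q i`, where `K` is absolutely unramified. -/
structure IsEisensteinRoot (K : Type*) {M : Type*} [Field K] [Field M] [Algebra K M]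
    (v : Valuation M ℝ≥0) (p : ℕ) (r : ℝ≥0) (q : ℕ → M) (π : M) : Prop
    extends IsReducedCoeffs v p r q where
  map_root : v π = r
  map_base : ∀ c : K, c ≠ 0 → ∃ n : ℤ, v (algebraMap K M c) = r ^ ((p : ℤ) ^ 2 * n)
  map_equiv : ∀ (σ : M ≃ₐ[K] M) (m : M), v (σ m) = v m
  isIntegral : IsIntegral K π
  natDegree : (minpoly K π).natDegree = p ^ 2
  aeval_minpoly : ∀ θ : M, θ ≠ 0 → aeval θ (minpoly K π) =
    θ ^ (p ^ 2) * (1 + p * ∑ i ∈ Finset.Icc 1 (p ^ 2), q i * θ⁻¹ ^ i)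

namespace IsEisensteinRoot

variable {K M : Type*} [Field K] [Field M] [Algebra K M] {v : Valuation M ℝ≥0} {p : ℕ} {r : ℝ≥0}
  {q : ℕ → M} {π : M}

theorem root_ne_zero (h : IsEisensteinRoot K v p r q π) : π ≠ 0 := by
  rintro rfl
  exact h.pos.ne (by rw [← h.map_root, map_zero])

theorem map_inv_root (h : IsEisensteinRoot K v p r q π) : v π⁻¹ = r ^ (-1 : ℤ) := by
  rw [map_inv₀, h.map_root, zpow_neg_one]

theorem map_zpow_root (h : IsEisensteinRoot K v p r q π) (n : ℤ) : v (π ^ n) = r ^ n := by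
  rw [map_zpow₀, h.map_root]

theorem map_equiv_inv_root (h : IsEisensteinRoot K v p r q π) (σ : M ≃ₐ[K] M) :
    v (σ π⁻¹) = r ^ (-1 : ℤ) := by
  rw [h.map_equiv, h.map_inv_root]

theorem sum_eq_zero (h : IsEisensteinRoot K v p r q π) (σ : M ≃ₐ[K] M) :
    ∑ i ∈ Finset.Icc 1 (p ^ 2), q i * ((σ π⁻¹) ^ i - π⁻¹ ^ i) = 0 := by
  have hpM : (p : M) ≠ 0 := by
    intro h0
    have := h.map_p
    rw [h0, map_zero] at this
    exact zpow_ne_zero _ h.pos.ne' this.symm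
  have key (θ : M) (hθ : θ ≠ 0) (h0 : aeval θ (minpoly K π) = 0) :
      (p : M) * ∑ i ∈ Finset.Icc 1 (p ^ 2), q i * θ⁻¹ ^ i = -1 := by
    rw [h.aeval_minpoly θ hθ] at h0
    have := (mul_eq_zero.mp h0).resolve_left (pow_ne_zero _ hθ)
    linear_combination this
  have h1 := key π h.root_ne_zero (minpoly.aeval K π)
  have h2 := key (σ π) ((map_ne_zero σ).mpr h.root_ne_zero) (by
    rw [aeval_algHom_apply, minpoly.aeval, map_zero])
  rw [← h2] at h1
  have h3 := mul_left_cancel₀ hpM h1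
  simp only [mul_sub, Finset.sum_sub_distrib, map_inv₀]
  rw [h3, sub_self]

theorem exists_eq_sum (h : IsEisensteinRoot K v p r q π) {l : M} (hl : l ∈ K⟮π⟯) :
    ∃ c : ℕ → K, l = ∑ i ∈ Finset.range (p ^ 2), algebraMap K M (c i) * π ^ i := by
  rw [← IntermediateField.mem_toSubalgebra,
    IntermediateField.adjoin_simple_toSubalgebra_of_isAlgebraic h.isIntegral.isAlgebraic,
    Algebra.adjoin_singleton_eq_range_aeval] at hl
  obtain ⟨P, rfl⟩ := hl
  refine ⟨fun i => (P %ₘ minpoly K π).coeff i, ?_⟩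
  have hmonic := minpoly.monic h.isIntegral
  have hlt : (P %ₘ minpoly K π).natDegree < p ^ 2 := by
    rw [← h.natDegree]
    exact natDegree_modByMonic_lt _ hmonic (minpoly.ne_one K π)
  have hP : aeval π P = aeval π (P %ₘ minpoly K π) := by
    conv_lhs => rw [← modByMonic_add_div P (minpoly K π)]
    simp [minpoly.aeval]
  change aeval π P = _
  rw [hP, aeval_eq_sum_range' hlt]
  simp [Algebra.smul_def]

theorem exists_terms (h : IsEisensteinRoot K v p r q π) (hp : p.Prime) {l : M} (hl : l ∈ K⟮π⟯) :
    ∃ c : ℕ → K, l = ∑ i ∈ Finset.range (p ^ 2), algebraMap K M (c i) * π ^ i ∧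
      (∀ i < p ^ 2, v (algebraMap K M (c i) * π ^ i) ≤ v l) := by
  obtain ⟨c, hc⟩ := h.exists_eq_sum hl
  obtain ⟨i, -, hi, hmax⟩ := v.exists_map_sum_eq h.pos h.lt_one (pow_pos hp.pos 2) h.map_root
    (by simpa using h.map_base) c
  refine ⟨c, hc, fun j hj => ?_⟩
  rw [hc, hi]
  exact hmax j hj

theorem exists_map_term_eq (h : IsEisensteinRoot K v p r q π) {c : K} (hc : c ≠ 0) (i : ℕ) :
    ∃ n : ℤ, v (algebraMap K M c * π ^ i) = r ^ ((p : ℤ) ^ 2 * n + i) := by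
  obtain ⟨n, hn⟩ := h.map_base c hc
  exact ⟨n, by rw [map_mul, map_pow, hn, h.map_root, zpow_add₀ h.pos.ne', zpow_natCast]⟩

theorem exists_map_eq (h : IsEisensteinRoot K v p r q π) (hp : p.Prime) {l : M} (hl : l ∈ K⟮π⟯)
    (hl0 : l ≠ 0) : ∃ n : ℤ, v l = r ^ n := by
  obtain ⟨c, rfl⟩ := h.exists_eq_sum hl
  obtain ⟨i, -, hi, hmax⟩ := v.exists_map_sum_eq h.pos h.lt_one (pow_pos hp.pos 2) h.map_root
    (by simpa using h.map_base) c
  rw [hi]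
  have hci : c i ≠ 0 := by
    intro h0
    rw [h0, map_zero, zero_mul, map_zero, map_eq_zero] at hi
    exact hl0 hi
  obtain ⟨n, hn⟩ := h.exists_map_term_eq hci i
  exact ⟨_, hn⟩

theorem map_le_of_lt_one (h : IsEisensteinRoot K v p r q π) (hp : p.Prime) {l : M}
    (hl : l ∈ K⟮π⟯) (hlt : v l < 1) : v l ≤ r := by
  rcases eq_or_ne l 0 with rfl | hl0
  · rw [map_zero]; exact zero_le
  obtain ⟨n, hn⟩ := h.exists_map_eq hp hl hl0
  rw [hn, ← zpow_zero r] at hlt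
  have : 0 < n := by
    by_contra! hn0
    exact absurd (h.zpow_le hn0) (not_le.mpr hlt)
  rw [hn]
  simpa using h.zpow_le (show (1 : ℤ) ≤ n by omega)

/-- After subtracting a suitable element of `K`, the value of an element of `K(π)` does not
belong to the value group of `K`. -/
theorem exists_sub_algebraMap (h : IsEisensteinRoot K v p r q π) (hp : p.Prime) {l : M}
    (hl : l ∈ K⟮π⟯) : ∃ c : K, v (algebraMap K M c) ≤ v l ∧ (l = algebraMap K M c ∨
      ∃ n : ℤ, v (l - algebraMap K M c) = r ^ n ∧ ¬ (p : ℤ) ^ 2 ∣ n) := by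
  obtain ⟨c, hlc, hmaxl⟩ := h.exists_terms hp hl
  have hpos : 0 < p ^ 2 := pow_pos hp.pos 2
  refine ⟨c 0, by simpa using hmaxl 0 hpos, or_iff_not_imp_left.mpr fun hne => ?_⟩
  have hsub : l - algebraMap K M (c 0) = ∑ i ∈ Finset.range (p ^ 2),
      algebraMap K M (if i = 0 then 0 else c i) * π ^ i := by
    rw [hlc, sub_eq_iff_eq_add]
    obtain ⟨N, hN⟩ : ∃ N, p ^ 2 = N + 1 := ⟨p ^ 2 - 1, by omega⟩
    rw [hN, Finset.sum_range_succ', Finset.sum_range_succ']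
    simp
  obtain ⟨i, hi, hval, -⟩ := v.exists_map_sum_eq h.pos h.lt_one hpos h.map_root
    (by simpa using h.map_base) (fun i => if i = 0 then 0 else c i)
  rw [← hsub] at hval
  have hci : (if i = 0 then 0 else c i) ≠ 0 := by
    intro h0
    rw [h0, map_zero, zero_mul, map_zero, map_eq_zero, sub_eq_zero] at hval
    exact hne hval
  obtain ⟨n, hn⟩ := h.exists_map_term_eq hci i
  refine ⟨_, hval.trans hn, fun hdvd => ?_⟩
  rw [Int.dvd_add_right (dvd_mul_right _ _)] at hdvd
  have : p ^ 2 ∣ i := by exact_mod_cast hdvd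
  have hi0 : i = 0 := Nat.eq_zero_of_dvd_of_lt this hi
  simp [hi0] at hci

theorem exists_map_sub_lt_one (h : IsEisensteinRoot K v p r q π) (hp : p.Prime) {l : M}
    (hl : l ∈ K⟮π⟯) (hle : v l ≤ 1) :
    ∃ c : K, v (algebraMap K M c) ≤ 1 ∧ v (l - algebraMap K M c) < 1 := by
  obtain ⟨c, hc, hcase⟩ := h.exists_sub_algebraMap hp hl
  refine ⟨c, hc.trans hle, ?_⟩
  rcases hcase with heq | ⟨n, hn, hdvd⟩
  · rw [heq, sub_self, map_zero]; exact one_pos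
  · refine lt_of_le_of_ne (v.map_sub_le hle (hc.trans hle)) fun h1 => hdvd ?_
    rw [h1, ← zpow_zero r] at hn
    rw [← zpow_right_injective₀ h.pos h.lt_one.ne hn]
    exact dvd_zero _

/-- Leading term of an element of `K(π)`. -/
theorem exists_map_sub_mul_zpow_le (h : IsEisensteinRoot K v p r q π) (hp : p.Prime) {l : M}
    (hl : l ∈ K⟮π⟯) {n : ℤ} (hle : v l ≤ r ^ n) :
    ∃ c : K, v (algebraMap K M c) ≤ 1 ∧ v (l - algebraMap K M c * π ^ n) ≤ r ^ (n + 1) := by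
  have hπ : π ∈ K⟮π⟯ := mem_adjoin_simple_self K π
  have hmem : l * π ^ (-n) ∈ K⟮π⟯ := mul_mem hl (zpow_mem hπ _)
  obtain ⟨c, hc, hlt⟩ := h.exists_map_sub_lt_one hp hmem (by
    rw [map_mul, h.map_zpow_root]
    calc _ ≤ r ^ n * r ^ (-n) := by gcongr
      _ = 1 := by rw [← zpow_add₀ h.pos.ne']; simp)
  refine ⟨c, hc, ?_⟩
  have h1 := h.map_le_of_lt_one hp (sub_mem hmem (IntermediateField.algebraMap_mem _ c)) hlt
  have heq : l - algebraMap K M c * π ^ n = (l * π ^ (-n) - algebraMap K M c) * π ^ n := by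
    rw [sub_mul, mul_assoc, ← zpow_add₀ h.root_ne_zero]; simp
  rw [heq, map_mul, h.map_zpow_root, zpow_add₀ h.pos.ne', zpow_one, mul_comm (r ^ n)]
  gcongr

/-- Automorphisms move an element of `K(π)` by at most as much, relatively, as they move `π`. -/
theorem map_apply_sub_le (h : IsEisensteinRoot K v p r q π) (hp : p.Prime) {l : M}
    (hl : l ∈ K⟮π⟯) (σ : M ≃ₐ[K] M) :
    v (σ l - l) ≤ v l * (r * v (π⁻¹ - σ π⁻¹)) := by
  obtain ⟨c, hlc, hmax⟩ := h.exists_terms hp hl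
  have hσ0 : σ π ≠ 0 := (map_ne_zero σ).mpr h.root_ne_zero
  have hπ : v (σ π - π) = r ^ 2 * v (π⁻¹ - σ π⁻¹) := by
    have : σ π - π = π * σ π * (π⁻¹ - σ π⁻¹) := by
      rw [map_inv₀]; have := h.root_ne_zero; field_simp
    rw [this, map_mul, map_mul, h.map_equiv, h.map_root, sq]
  have heq : σ l - l = ∑ i ∈ Finset.range (p ^ 2),
      algebraMap K M (c i) * ((σ π) ^ i - π ^ i) := by
    rw [hlc, map_sum, ← Finset.sum_sub_distrib]
    refine Finset.sum_congr rfl fun i _ => ?_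
    rw [map_mul, map_pow, AlgEquiv.commutes, mul_sub]
  rw [heq]
  refine v.map_sum_le fun i hi => ?_
  rcases i with _ | i
  · simp
  · calc _ ≤ v (algebraMap K M (c (i + 1))) * (r ^ i * v (σ π - π)) := by
          rw [map_mul]
          gcongr
          exact v.map_pow_sub_pow_le (by rw [h.map_equiv, h.map_root]) h.map_root.le i
      _ = v (algebraMap K M (c (i + 1)) * π ^ (i + 1)) * (r * v (π⁻¹ - σ π⁻¹)) := by
          rw [hπ, map_mul, map_pow, h.map_root]; ring
      _ ≤ _ := by gcongr; exact hmax _ (Finset.mem_range.mp hi)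

end IsEisensteinRoot

/-- An automorphism of order dividing `p` which is too close to the identity is the identity. -/
theorem Valuation.algEquiv_eq_one_of_map_apply_sub_le {K F : Type*} [Field K] [Field F]
    [Algebra K F] (u : Valuation F ℝ≥0) {p : ℕ} (hp : p.Prime) (τ : F ≃ₐ[K] F) (hτ : τ ^ p = 1)
    {s : ℝ≥0} (hs1 : s < 1) (hsp : s ^ (p - 1) < u (p : F))
    (hle : ∀ y, u (τ y - y) ≤ s * u y) : τ = 1 := by
  obtain ⟨n, hn⟩ : ∃ n, p = n + 2 := ⟨p - 2, by have := hp.two_le; omega⟩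
  set D : Module.End K F := (τ.toLinearMap : Module.End K F) - 1 with hD
  have hDy (y : F) : D y = τ y - y := rfl
  have hpow (k : ℕ) : ((τ.toLinearMap : Module.End K F) ^ k) = (τ ^ k).toLinearMap := by
    induction k with
    | zero => rfl
    | succ k ih => rw [pow_succ, pow_succ, ih]; rfl
  have hone : (D + 1) ^ p = 1 := by
    rw [hD, sub_add_cancel, hpow, hτ]; rfl
  have hDle (k : ℕ) (y : F) : u ((D ^ k) y) ≤ s ^ k * u y := by
    induction k with
    | zero => simp
    | succ k ih =>
      rw [pow_succ', Module.End.mul_apply, hDy]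
      calc _ ≤ s * u ((D ^ k) y) := hle _
        _ ≤ s * (s ^ k * u y) := by gcongr
        _ = _ := by ring
  ext y
  by_contra hne
  have hDne : D y ≠ 0 := by rw [hDy]; exact sub_ne_zero.mpr hne
  have hDpos : 0 < u (D y) := by rwa [Valuation.pos_iff]
  have hs1' : s < 1 := hs1
  have hexp := congrArg (fun E : Module.End K F => E y) hone
  simp only [(Commute.one_right D).add_pow, one_pow, mul_one, LinearMap.sum_apply,
    Module.End.one_apply] at hexp
  have hterm (k : ℕ) : (D ^ k * ((p.choose k : ℕ) : Module.End K F)) y =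
      (p.choose k : F) * (D ^ k) y := by
    rw [(Nat.cast_commute (p.choose k) (D ^ k)).symm.eq, Module.End.mul_apply,
      Module.End.natCast_apply, nsmul_eq_mul]
  simp only [hterm] at hexp
  rw [hn, Finset.sum_range_succ', Finset.sum_range_succ', ← hn] at hexp
  simp only [zero_add, pow_one, Nat.choose_one_right, pow_zero, Nat.choose_zero_right,
    Nat.cast_one, one_mul, Module.End.one_apply] at hexp
  have hmain : (p : F) * D y =
      - ∑ k ∈ Finset.range (n + 1), (p.choose (k + 1 + 1) : F) * (D ^ (k + 1 + 1)) y := by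
    linear_combination hexp
  have hu0 : u (p : F) * u (D y) ≠ 0 := by
    refine (mul_pos (zero_le.trans_lt hsp) hDpos).ne'
  have hlt : u ((p : F) * D y) < u (p : F) * u (D y) := by
    rw [hmain, u.map_neg]
    refine u.map_sum_lt hu0 fun k hk => ?_
    have hk' := Finset.mem_range.mp hk
    rw [map_mul, pow_succ, Module.End.mul_apply]
    have hb := hDle (k + 1) (D y)
    rcases Nat.lt_succ_iff_lt_or_eq.mp hk' with hlt | rfl
    · have hdvd : p ∣ p.choose (k + 1 + 1) :=
        hp.dvd_choose_self (by omega) (by omega)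
      have hup : u (p.choose (k + 1 + 1) : F) ≤ u (p : F) := by
        obtain ⟨t, ht⟩ := hdvd
        rw [ht, Nat.cast_mul, map_mul]
        exact mul_le_of_le_one_right zero_le (u.map_natCast_le_one t)
      calc _ ≤ u (p : F) * (s ^ (k + 1) * u (D y)) := by gcongr
        _ < u (p : F) * u (D y) := by
          refine mul_lt_mul_of_pos_left ?_ (zero_le.trans_lt hsp)
          exact mul_lt_of_lt_one_left hDpos (pow_lt_one₀ zero_le hs1 (by omega))
    · calc _ ≤ 1 * (s ^ (k + 1) * u (D y)) := by
            gcongr; exact u.map_natCast_le_one _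
        _ < u (p : F) * u (D y) := by
          rw [one_mul]
          refine mul_lt_mul_of_pos_right ?_ hDpos
          convert hsp using 2; omega
  rw [map_mul] at hlt
  exact lt_irrefl _ hlt

namespace IsEisensteinRoot

section Subextension

variable {K M F : Type*} [Field K] [Field M] [Field F] [Algebra K M] [Algebra K F]
  {v : Valuation M ℝ≥0} {p : ℕ} {r : ℝ≥0} {q : ℕ → M} {π : M}

theorem exists_lift [Normal K M] (j : F →ₐ[K] M) (τ : F ≃ₐ[K] F) :
    ∃ σ : M ≃ₐ[K] M, ∀ y, σ (j y) = j (τ y) := by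
  let : Algebra F M := j.toRingHom.toAlgebra
  have : IsScalarTower K F M := IsScalarTower.of_algebraMap_eq fun x => (j.commutes x).symm
  exact ⟨τ.liftNormal M, fun y => τ.liftNormal_commutes M y⟩

theorem map_apply_algEquiv [Normal K M] (h : IsEisensteinRoot K v p r q π) (j : F →ₐ[K] M)
    (τ : F ≃ₐ[K] F) (y : F) : v (j (τ y)) = v (j y) := by
  obtain ⟨σ, hσ⟩ := exists_lift j τ
  rw [← hσ, h.map_equiv]

theorem exists_map_eq_of_finrank [Normal K M] [IsGalois K F] (h : IsEisensteinRoot K v p r q π)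
    (hp : p.Prime) (hF : Module.finrank K F = p) (j : F →ₐ[K] M) {y : F} (hy : y ≠ 0) :
    ∃ n : ℤ, v (j y) = r ^ ((p : ℤ) * n) := by
  have : FiniteDimensional K F := Module.finite_of_finrank_pos (hF ▸ hp.pos)
  have hnorm : v (algebraMap K M (Algebra.norm K y)) = v (j y) ^ p := by
    rw [← j.commutes, Algebra.norm_eq_prod_automorphisms, map_prod, map_prod]
    simp only [h.map_apply_algEquiv j, Finset.prod_const]
    rw [Finset.card_univ, ← Nat.card_eq_fintype_card, IsGalois.card_aut_eq_finrank, hF]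
  obtain ⟨n, hn⟩ := h.map_base (Algebra.norm K y) (Algebra.norm_ne_zero_iff.mpr hy)
  refine ⟨n, ?_⟩
  rw [hnorm] at hn
  rw [← pow_left_inj₀ zero_le zero_le hp.ne_zero, hn, ← zpow_natCast, ← zpow_mul]
  congr 1; ring

/-- The values on a subextension of degree `p` are powers of `r ^ p`. -/
theorem map_le_of_lt_zpow [Normal K M] [IsGalois K F] (h : IsEisensteinRoot K v p r q π)
    (hp : p.Prime) (hF : Module.finrank K F = p) (j : F →ₐ[K] M) {y : F} {m : ℤ}
    (hy : v (j y) < r ^ ((p : ℤ) * (m - 1))) : v (j y) ≤ r ^ ((p : ℤ) * m) := by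
  rcases eq_or_ne y 0 with rfl | hy0
  · rw [map_zero, map_zero]; exact zero_le
  obtain ⟨n, hn⟩ := h.exists_map_eq_of_finrank hp hF j hy0
  rw [hn] at hy ⊢
  have hpZ : (0 : ℤ) < p := by exact_mod_cast hp.pos
  refine h.zpow_le (mul_le_mul_of_nonneg_left ?_ hpZ.le)
  by_contra! hlt
  exact absurd (h.zpow_le (mul_le_mul_of_nonneg_left (show n ≤ m - 1 by omega) hpZ.le))
    (not_le.mpr hy)

/-- A subextension of degree `p` contains an element of valuation `r ^ (-p)`. -/
theorem exists_map_eq_zpow_neg [Normal K M] [IsGalois K F] (h : IsEisensteinRoot K v p r q π)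
    (hp : p.Prime) (hF : Module.finrank K F = p) (j : F →ₐ[K] M) (hj : ∀ y, j y ∈ K⟮π⟯) :
    ∃ φ : F, v (j φ) = r ^ (-(p : ℤ)) := by
  have hpZ : (p : ℤ) ≠ 0 := by exact_mod_cast hp.ne_zero
  have hz : ∃ z : F, z ∉ (⊥ : Subalgebra K F) := by
    by_contra! hall
    have : (⊥ : Subalgebra K F) = ⊤ := by rw [eq_top_iff]; exact fun z _ => hall z
    rw [Subalgebra.bot_eq_top_iff_finrank_eq_one, hF] at this
    exact hp.one_lt.ne' this
  obtain ⟨z, hz⟩ := hz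
  obtain ⟨c, -, hc⟩ := h.exists_sub_algebraMap hp (hj z)
  rcases hc with heq | ⟨n, hn, hdvd⟩
  · rw [← j.commutes] at heq
    exact absurd (j.injective heq ▸ Subalgebra.algebraMap_mem _ c) hz
  · rw [← j.commutes, ← map_sub] at hn
    have hne : z - algebraMap K F c ≠ 0 := by
      intro h0
      rw [h0, map_zero, map_zero] at hn
      exact zpow_ne_zero _ h.pos.ne' hn.symm
    obtain ⟨m, hm⟩ := h.exists_map_eq_of_finrank hp hF j hne
    have hnm : n = p * m := zpow_right_injective₀ h.pos h.lt_one.ne (hn.symm.trans hm)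
    have hpm : ¬ (p : ℤ) ∣ m := fun hd => hdvd (by
      rw [hnm, sq]; exact mul_dvd_mul_left _ hd)
    obtain ⟨s, t, hst⟩ := ((Nat.prime_iff_prime_int.mp hp).coprime_iff_not_dvd.mpr hpm)
    refine ⟨(p : F) ^ (-s) * (z - algebraMap K F c) ^ (-t), ?_⟩
    rw [map_mul, map_zpow₀, map_zpow₀, map_natCast, map_mul, map_zpow₀, map_zpow₀, hm, h.map_p,
      ← zpow_mul, ← zpow_mul, ← zpow_add₀ h.pos.ne']
    congr 1
    linear_combination (-(p : ℤ)) * hst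

/-- If an element of valuation `r ^ (-p)` is moved too little, then every element is. -/
theorem map_apply_sub_le_of_lt_one [Normal K M] [IsGalois K F]
    (h : IsEisensteinRoot K v p r q π)
    (hp : p.Prime) (hF : Module.finrank K F = p) (j : F →ₐ[K] M) (hj : ∀ y, j y ∈ K⟮π⟯)
    (τ : F ≃ₐ[K] F) {φ : F} (hφ : v (j φ) = r ^ (-(p : ℤ))) (hlt : v (j (τ φ - φ)) < 1) (y : F) :
    v (j (τ y - y)) ≤ r ^ (2 * (p : ℤ)) * v (j y) := by
  have hr0 := h.pos.ne'
  have hpZ : (0 : ℤ) < p := by exact_mod_cast hp.pos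
  have hφ0 : φ ≠ 0 := by
    rintro rfl
    rw [map_zero, map_zero] at hφ
    exact zpow_ne_zero _ hr0 hφ.symm
  have hDφ : v (j (τ φ - φ)) ≤ r ^ (p : ℤ) := by
    have := h.map_le_of_lt_zpow hp hF j (y := τ φ - φ) (m := 1)
      (by rwa [sub_self, mul_zero, zpow_zero])
    simpa using this
  set u := τ φ / φ with hu
  have huv : v (j u) = 1 := by
    rw [hu, map_div₀, map_div₀, h.map_apply_algEquiv j, div_self]
    rw [hφ]; exact zpow_ne_zero _ hr0
  have hu1 : v (j u - 1) ≤ r ^ (2 * (p : ℤ)) := by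
    have : j u - 1 = j (τ φ - φ) / j φ := by
      rw [← map_div₀, sub_div, div_self hφ0, map_sub, map_one]
    rw [this, map_div₀, hφ, div_eq_mul_inv, ← zpow_neg, neg_neg]
    calc _ ≤ r ^ (p : ℤ) * r ^ (p : ℤ) := by gcongr
      _ = _ := by rw [← zpow_add₀ hr0, two_mul]
  have hunat (n : ℕ) : v (j u ^ n - 1) ≤ r ^ (2 * (p : ℤ)) := by
    rcases n with _ | n
    · simp
    · have := v.map_pow_sub_pow_le huv.le v.map_one.le n
      rw [one_pow, one_pow, one_mul] at this
      exact this.trans hu1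
  have huint (n : ℤ) : v (j u ^ n - 1) ≤ r ^ (2 * (p : ℤ)) := by
    have hju0 : j u ≠ 0 := by intro h0; rw [h0, map_zero] at huv; exact zero_ne_one huv
    rcases n.eq_nat_or_neg with ⟨n, rfl | rfl⟩
    · simpa using hunat n
    · have : j u ^ (-(n : ℤ)) - 1 = - ((j u ^ n)⁻¹ * (j u ^ n - 1)) := by
        rw [zpow_neg, zpow_natCast, mul_sub, inv_mul_cancel₀ (pow_ne_zero _ hju0)]; ring
      rw [this, v.map_neg, map_mul, map_inv₀, map_pow, huv, one_pow, inv_one, one_mul]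
      exact hunat n
  have hDpow (n : ℤ) : v (j (τ (φ ^ n) - φ ^ n)) ≤ r ^ (2 * (p : ℤ)) * v (j (φ ^ n)) := by
    have : j (τ (φ ^ n) - φ ^ n) = (j u ^ n - 1) * j (φ ^ n) := by
      rw [← map_zpow₀, hu, div_zpow, map_sub, sub_mul, one_mul, ← map_mul,
        div_mul_cancel₀ _ (zpow_ne_zero _ hφ0), map_zpow₀]
    rw [this, map_mul]
    exact mul_le_mul_left (huint n) _
  have step {s : ℝ≥0} (hs : ∀ y, v (j (τ y - y)) ≤ s * v (j y)) (y : F) :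
      v (j (τ y - y)) ≤ max (r ^ (2 * (p : ℤ))) (s * r ^ (p : ℤ)) * v (j y) := by
    rcases eq_or_ne y 0 with rfl | hy0
    · simp
    obtain ⟨n, hn⟩ := h.exists_map_eq_of_finrank hp hF j hy0
    have hφn : v (j (φ ^ (-n))) = v (j y) := by
      rw [map_zpow₀, map_zpow₀, hφ, hn, ← zpow_mul]; congr 1; ring
    have hzv : v (j (y * φ ^ n)) = 1 := by
      rw [map_mul, map_mul, map_zpow₀, map_zpow₀, hφ, hn, ← zpow_mul, ← zpow_add₀ hr0]
      rw [← zpow_zero r]; congr 1; ring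
    obtain ⟨b, hb, hzb⟩ := h.exists_map_sub_lt_one hp (hj (y * φ ^ n)) hzv.le
    rw [← j.commutes, ← map_sub] at hzb
    have hzb' : v (j (y * φ ^ n - algebraMap K F b)) ≤ r ^ (p : ℤ) := by
      have := h.map_le_of_lt_zpow hp hF j (m := 1)
        (y := y * φ ^ n - algebraMap K F b) (by rwa [sub_self, mul_zero, zpow_zero])
      simpa using this
    set y' := (y * φ ^ n - algebraMap K F b) * φ ^ (-n) with hy'
    have hy'v : v (j y') ≤ r ^ (p : ℤ) * v (j y) := by
      rw [hy', map_mul, map_mul, hφn]; gcongr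
    have hyeq : y = algebraMap K F b * φ ^ (-n) + y' := by
      rw [hy', sub_mul, mul_assoc, ← zpow_add₀ hφ0, add_neg_cancel, zpow_zero]; ring
    have hD : j (τ y - y) = algebraMap K M b * j (τ (φ ^ (-n)) - φ ^ (-n)) + j (τ y' - y') := by
      conv_lhs => rw [hyeq]
      rw [map_add τ, map_mul τ, τ.commutes, ← j.commutes, ← map_mul, ← map_add]
      congr 1; ring
    rw [hD, max_mul_of_nonneg _ _ zero_le]
    refine (v.map_add _ _).trans (max_le_max ?_ ?_)
    · rw [map_mul]
      calc _ ≤ 1 * (r ^ (2 * (p : ℤ)) * v (j (φ ^ (-n)))) := by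
            gcongr; exact hDpow _
        _ = _ := by rw [one_mul, hφn]
    · calc _ ≤ s * v (j y') := hs _
        _ ≤ s * (r ^ (p : ℤ) * v (j y)) := by gcongr
        _ = _ := by ring
  have h0 (y : F) : v (j (τ y - y)) ≤ 1 * v (j y) := by
    rw [one_mul, map_sub]
    exact v.map_sub_le (h.map_apply_algEquiv j τ y).le le_rfl
  have h2 : r ^ (2 * (p : ℤ)) ≤ r ^ (p : ℤ) := h.zpow_le (by linarith)
  have h1 := step h0
  rw [one_mul, max_eq_right h2] at h1
  have h3 := step h1 y
  rwa [← zpow_add₀ hr0, ← two_mul, max_self] at h3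

end Subextension

end IsEisensteinRoot

namespace IsEisensteinRoot

variable {K M F : Type*} [Field K] [Field M] [Field F] [Algebra K M] [Algebra K F]
  {v : Valuation M ℝ≥0} {p : ℕ} {r : ℝ≥0} {q : ℕ → M} {π : M}

/-- An element of `K(π)` with a pole of order less than `p` whose difference with a conjugate is
integral has at most a simple pole. -/
theorem exists_map_sub_mul_inv_le_one (h : IsEisensteinRoot K v p r q π) (hp : p.Prime) {β : M}
    (hβ : β ∈ K⟮π⟯) (hle : v β ≤ r ^ (1 - (p : ℤ))) (σ : M ≃ₐ[K] M)
    (hσ : v (π⁻¹ - σ π⁻¹) = 1) (hdiff : v (σ β - β) ≤ 1) :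
    ∃ b : K, v (algebraMap K M b) ≤ 1 ∧ v (β - algebraMap K M b * π⁻¹) ≤ 1 := by
  have hr0 := h.pos.ne'
  by_cases hβ1 : v β ≤ 1
  · exact ⟨0, by simp, by simpa using hβ1⟩
  push Not at hβ1
  have hβ0 : β ≠ 0 := by rintro rfl; simp at hβ1
  obtain ⟨n, hn⟩ := h.exists_map_eq hp hβ hβ0
  rw [hn, h.toIsReducedCoeffs.zpow_le_iff] at hle
  have hn0 : n < 0 := by
    by_contra! hc
    have := h.zpow_le hc
    rw [← hn, zpow_zero] at this
    exact absurd hβ1 (not_lt.mpr this)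
  obtain ⟨s, rfl⟩ : ∃ s : ℕ, n = -s := ⟨n.natAbs, by omega⟩
  obtain ⟨b, hb, hsub⟩ := h.exists_map_sub_mul_zpow_le hp hβ hn.le
  refine ⟨b, hb, ?_⟩
  have hs0 : s ≠ 0 := by rintro rfl; simp at hn0
  rcases eq_or_ne s 1 with rfl | hs1
  · simpa using hsub
  exfalso
  have hps : ¬ p ∣ s := Nat.not_dvd_of_pos_of_lt (by omega) (by omega)
  have hπs : π ^ (-(s : ℤ)) = π⁻¹ ^ s := by rw [zpow_neg, zpow_natCast, inv_pow]
  set β' := β - algebraMap K M b * π ^ (-(s : ℤ)) with hβ'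
  have hbv : v (algebraMap K M b) = 1 := by
    have hval : v (algebraMap K M b * π ^ (-(s : ℤ))) = v β := by
      refine (v.map_eq_of_sub_lt ?_)
      rw [v.map_sub_swap, ← hβ', hn]
      exact hsub.trans_lt (h.zpow_lt (by linarith))
    rw [map_mul, h.map_zpow_root, hn] at hval
    exact mul_right_cancel₀ (zpow_ne_zero _ hr0) (by rw [hval, one_mul])
  have hβ'mem : β' ∈ K⟮π⟯ := sub_mem hβ (mul_mem (IntermediateField.algebraMap_mem _ b)
    (zpow_mem (mem_adjoin_simple_self K π) _))
  have heq : σ β - β = algebraMap K M b * ((σ π⁻¹) ^ s - π⁻¹ ^ s) + (σ β' - β') := by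
    rw [hβ', hπs, map_sub, map_mul, map_pow, AlgEquiv.commutes]; ring
  have h1 : v (algebraMap K M b * ((σ π⁻¹) ^ s - π⁻¹ ^ s)) = r ^ (1 - (s : ℤ)) := by
    rw [map_mul, hbv, one_mul]
    exact h.map_pow_sub_pow_eq hp h.map_inv_root (h.map_equiv_inv_root σ) hσ hps
  have h2 : v (σ β' - β') < r ^ (1 - (s : ℤ)) := by
    refine (h.map_apply_sub_le hp hβ'mem σ).trans_lt ?_
    rw [hσ, mul_one]
    calc _ ≤ r ^ (-(s : ℤ) + 1) * r ^ (1 : ℤ) := by rw [zpow_one]; gcongr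
      _ = r ^ (2 - (s : ℤ)) := by rw [← zpow_add₀ hr0]; congr 1; ring
      _ < _ := h.zpow_lt (by linarith)
  rw [heq, v.map_add_eq_of_lt_left (by rwa [h1]), h1, ← zpow_zero r,
    h.toIsReducedCoeffs.zpow_le_iff] at hdiff
  omega

theorem map_add_pow_sub_lt_one (h : IsEisensteinRoot K v p r q π) (hp : p.Prime) (hodd : Odd p)
    {a b : M} (ha : v a ≤ 1) (hb : v b ≤ 1) : v ((a + b) ^ p - (a ^ p + b ^ p)) < 1 := by
  have h1 := v.map_prime_pow_sub_le hp hodd (x := a + b) (y := b) (v.map_add_le ha hb) hb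
  rw [add_sub_cancel_right, one_pow, mul_one] at h1
  have h2 : (a + b) ^ p - (a ^ p + b ^ p) = -(b ^ p - (a + b) ^ p + a ^ p) := by ring
  rw [h2, v.map_neg]
  exact h1.trans_lt (mul_lt_one_of_nonneg_of_lt_one_left zero_le (h.map_p_lt_one hp) ha)

/-- A Galois subextension of `K(π)` of degree `p` gives a unit of `K` which is a residual root of
the polynomial `q (p ^ 2) X ^ p + q p X`. -/
theorem exists_residual_root [Normal K M] [IsGalois K F] (h : IsEisensteinRoot K v p r q π)
    (hp : p.Prime) (hodd : Odd p) (hF : Module.finrank K F = p) (j : F →ₐ[K] M)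
    (hj : ∀ y, j y ∈ K⟮π⟯) {A B : K} (hA : q p = algebraMap K M A)
    (hB : q (p ^ 2) = algebraMap K M B) :
    ∃ c : K, v (algebraMap K M c) = 1 ∧ v (algebraMap K M (B * c ^ p + A * c)) < 1 := by
  have hr0 := h.pos.ne'
  have hpZ : (0 : ℤ) < p := by exact_mod_cast hp.pos
  have hsq := IsReducedCoeffs.two_mul_add_one_le_sq hp hodd
  have hr1 : r < 1 := h.lt_one
  have : FiniteDimensional K F := Module.finite_of_finrank_pos (hF ▸ hp.pos)
  have hcard : Nat.card (F ≃ₐ[K] F) = p := by rw [IsGalois.card_aut_eq_finrank, hF]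
  have hτp (τ : F ≃ₐ[K] F) : τ ^ p = 1 := by rw [← hcard]; exact pow_card_eq_one'
  have : Nontrivial (F ≃ₐ[K] F) :=
    (Finite.one_lt_card_iff_nontrivial).mp (by rw [hcard]; exact hp.one_lt)
  obtain ⟨τ, hτ⟩ := exists_ne (1 : F ≃ₐ[K] F)
  obtain ⟨σ, hσ⟩ := exists_lift j τ
  obtain ⟨φ, hφ⟩ := h.exists_map_eq_zpow_neg hp hF j hj
  have hx := h.map_inv_root
  have hσx := h.map_equiv_inv_root σ
  have hroot := h.sum_eq_zero σ
  obtain ⟨he1, hw1, hres⟩ := h.map_sub_le_one hp hodd hx hσx hroot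
  have hclose := h.map_sub_le_of_lt hp hodd hx hσx hroot
  have hpow := h.map_pow_sub_sub_pow_le hp hodd hx hσx
  have hδσ : j (τ φ - φ) = σ (j φ) - j φ := by rw [map_sub, hσ]
  have hδ := h.map_apply_sub_le hp (hj φ) σ
  rw [← hδσ, hφ] at hδ
  have hδ1 : v (j (τ φ - φ)) = 1 := by
    refine le_antisymm ?_ (not_lt.mp fun hlt => hτ ?_)
    · have := h.map_le_of_lt_zpow hp hF j (y := τ φ - φ) (m := 0) ?_
      · simpa using this
      · refine hδ.trans_lt ?_
        calc _ ≤ r ^ (-(p : ℤ)) * (r * 1) := by gcongr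
          _ < r ^ (-(p : ℤ)) * 1 :=
            mul_lt_mul_of_pos_left (by rwa [mul_one]) (zpow_pos h.pos _)
          _ = _ := by rw [mul_one]; congr 1; ring
    · refine (v.comap j.toRingHom).algEquiv_eq_one_of_map_apply_sub_le hp τ (hτp τ)
        (s := r ^ (2 * (p : ℤ))) ?_ ?_
        (h.map_apply_sub_le_of_lt_one hp hF j hj τ hφ hlt)
      · rw [← zpow_zero r]; exact h.zpow_lt (by linarith)
      · have : (v.comap j.toRingHom) (p : F) = r ^ ((p : ℤ) ^ 2) := by
          rw [← h.map_p]; simp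
        rw [this, ← zpow_natCast, ← zpow_mul]
        refine h.zpow_lt ?_
        push_cast [hp.one_le]
        nlinarith
  set x := π⁻¹ with hxdef
  set y := σ x with hydef
  set e := x ^ p - y ^ p with hedef
  set w := x - y with hwdef
  have hwe : v (e - w ^ p) < 1 := by
    refine hpow.trans_lt ?_
    calc _ ≤ r ^ ((p : ℤ) ^ 2 - p + 1) * 1 := by gcongr
      _ < 1 := by rw [mul_one, ← zpow_zero r]; exact h.zpow_lt (by linarith)
  have he : v e = 1 := by
    refine le_antisymm he1 (not_lt.mp fun hlt => ?_)
    have hlt1 : v (j (τ φ - φ)) < 1 := by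
      calc _ ≤ r ^ (-(p : ℤ)) * (r * r ^ (p : ℤ)) := hδ.trans (by gcongr; exact hclose hlt)
        _ = r := by rw [mul_left_comm, ← zpow_add₀ hr0]; simp
        _ < 1 := hr1
    exact hlt1.ne hδ1
  have hw : v w = 1 := by
    refine le_antisymm hw1 (not_lt.mp fun hlt => ?_)
    have : v e < 1 := by
      rw [← sub_add_cancel e (w ^ p)]
      refine v.map_add_lt hwe ?_
      rw [map_pow]; exact pow_lt_one₀ zero_le hlt hp.ne_zero
    exact this.ne he
  -- the principal part of `φ`
  obtain ⟨b₀, hb₀, hβ⟩ := h.exists_map_sub_mul_zpow_le hp (hj φ) hφ.le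
  have hπp : π ^ (-(p : ℤ)) = x ^ p := by rw [zpow_neg, zpow_natCast, hxdef, inv_pow]
  rw [hπp] at hβ
  set β := j φ - algebraMap K M b₀ * x ^ p with hβdef
  have hxmem : x ∈ K⟮π⟯ := inv_mem (mem_adjoin_simple_self K π)
  have hβmem : β ∈ K⟮π⟯ := sub_mem (hj φ) (mul_mem (IntermediateField.algebraMap_mem _ _)
    (pow_mem hxmem p))
  have hσβ : σ β - β = j (τ φ - φ) + algebraMap K M b₀ * e := by
    rw [hδσ, hβdef, hedef, map_sub, map_mul, map_pow, AlgEquiv.commutes]; ring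
  obtain ⟨b₁, hb₁, hψ⟩ := h.exists_map_sub_mul_inv_le_one hp hβmem
    (by rwa [neg_add_eq_sub] at hβ) σ hw (by
      rw [hσβ]
      refine v.map_add_le hδ1.le ?_
      rw [map_mul, he, mul_one]; exact hb₀)
  set ψ := β - algebraMap K M b₁ * x with hψdef
  have hψmem : ψ ∈ K⟮π⟯ := sub_mem hβmem (mul_mem (IntermediateField.algebraMap_mem _ _) hxmem)
  have hσψ : v (σ ψ - ψ) < 1 := by
    refine (h.map_apply_sub_le hp hψmem σ).trans_lt ?_
    rw [hw, mul_one]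
    exact mul_lt_one_of_nonneg_of_lt_one_right hψ zero_le hr1
  have hδeq : j (τ φ - φ) + (algebraMap K M b₀ * e + algebraMap K M b₁ * w) = σ ψ - ψ := by
    rw [hψdef, map_sub σ, map_mul σ, AlgEquiv.commutes, sub_sub_sub_comm, hσβ, ← hydef]
    ring
  obtain ⟨d, hd, hδd⟩ := h.exists_map_sub_lt_one hp (hj (τ φ - φ)) hδ1.le
  have hd1 : v (algebraMap K M d) = 1 := by
    rw [← hδ1]
    exact v.map_eq_of_sub_lt (by rwa [v.map_sub_swap, hδ1])
  set Y := algebraMap K M b₀ * e + algebraMap K M b₁ * w with hY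
  have hYe : v (algebraMap K M b₀ * e) ≤ 1 := by rwa [map_mul, he, mul_one]
  have hYw : v (algebraMap K M b₁ * w) ≤ 1 := by rwa [map_mul, hw, mul_one]
  have hYp := h.map_add_pow_sub_lt_one hp hodd hYe hYw
  rw [← hY] at hYp
  have hdY : v (algebraMap K M d - (-Y)) < 1 := by
    have : algebraMap K M d - (-Y) = (σ ψ - ψ) - (j (τ φ - φ) - algebraMap K M d) := by
      rw [← hδeq]; ring
    rw [this]
    exact v.map_sub_lt hσψ hδd
  have hdYp : v (algebraMap K M d ^ p + Y ^ p) < 1 := by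
    have h1 : p - 1 + 1 = p := by have := hp.pos; omega
    have h2 := v.map_pow_sub_pow_le hd (y := -Y)
      (by rw [v.map_neg]; exact v.map_add_le hYe hYw) (p - 1)
    rw [h1, hodd.neg_pow, sub_neg_eq_add, one_pow, one_mul] at h2
    exact h2.trans_lt hdY
  set m := b₀ ^ p * A - b₁ ^ p * B with hm
  have hvA : v (algebraMap K M A) = 1 := by rw [← hA, h.mid]
  have hvB : v (algebraMap K M B) = 1 := by rw [← hB, h.top]
  rw [hA, hB] at hres
  have hmain : v (algebraMap K M (B * d ^ p) - e * algebraMap K M m) < 1 := by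
    have heq : algebraMap K M (B * d ^ p) - e * algebraMap K M m =
        algebraMap K M B * (algebraMap K M d ^ p + Y ^ p) -
        algebraMap K M B * (Y ^ p - ((algebraMap K M b₀ * e) ^ p + (algebraMap K M b₁ * w) ^ p)) -
        algebraMap K M b₀ ^ p * (algebraMap K M B * e ^ p + algebraMap K M A * e) +
        algebraMap K M b₁ ^ p * algebraMap K M B * (e - w ^ p) := by
      rw [hm]; simp only [map_mul, map_sub, map_pow, mul_pow]; ring
    rw [heq]
    refine v.map_add_lt (v.map_sub_lt (v.map_sub_lt ?_ ?_) ?_) ?_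
    · rwa [map_mul, hvB, one_mul]
    · rwa [map_mul, hvB, one_mul]
    · rw [map_mul, map_pow]
      exact mul_lt_one_of_nonneg_of_lt_one_right (pow_le_one₀ zero_le hb₀) zero_le hres
    · rw [map_mul, map_mul, hvB, map_pow, mul_one]
      exact mul_lt_one_of_nonneg_of_lt_one_right (pow_le_one₀ zero_le hb₁) zero_le hwe
  have hBd : v (algebraMap K M (B * d ^ p)) = 1 := by
    rw [map_mul, map_mul, map_pow, map_pow, hvB, hd1, one_pow, one_mul]
  have hm1 : v (algebraMap K M m) = 1 := by
    have : v (e * algebraMap K M m) = v (algebraMap K M (B * d ^ p)) :=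
      v.map_eq_of_sub_lt (by rwa [v.map_sub_swap, hBd])
    rwa [map_mul, he, one_mul, hBd] at this
  have hm0 : algebraMap K M m ≠ 0 := by
    intro h0; rw [h0, map_zero] at hm1; exact zero_ne_one hm1
  refine ⟨B * d ^ p / m, by rw [map_div₀, map_div₀, hBd, hm1, div_one], ?_⟩
  have hsub : v (algebraMap K M (B * d ^ p / m) - e) < 1 := by
    have : algebraMap K M (B * d ^ p / m) - e =
        (algebraMap K M (B * d ^ p) - e * algebraMap K M m) / algebraMap K M m := by
      rw [map_div₀]; field_simp
    rw [this, map_div₀, hm1, div_one]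
    exact hmain
  have := h.map_add_lt_one_of_map_sub_lt_one hp hsub he.le (by rwa [hA, hB])
  rw [hA, hB] at this
  rwa [map_add, map_mul, map_mul, map_pow]

end IsEisensteinRoot

theorem Valuation.exists_intCast_sub_lt_one {M : Type*} [Field M] (v : Valuation M ℝ≥0) {p : ℕ}
    (hp : p.Prime) (hvp : v (p : M) < 1) {t : M} (ht : v t ≤ 1) (htp : v (t ^ p - t) < 1) :
    ∃ n : ℤ, v (t - n) < 1 := by
  have : Fact p.Prime := ⟨hp⟩
  let R := IsLocalRing.ResidueField v.valuationSubring
  have hres (z : v.valuationSubring) : IsLocalRing.residue v.valuationSubring z = 0 ↔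
      v (z : M) < 1 := by
    rw [IsLocalRing.residue_eq_zero_iff, v.mem_maximalIdeal_iff]
  have : CharP R p := by
    rw [CharP.charP_iff_prime_eq_zero hp, ← map_natCast (IsLocalRing.residue v.valuationSubring),
      hres]
    simpa using hvp
  let z : v.valuationSubring := ⟨t, ht⟩
  have hz : IsLocalRing.residue v.valuationSubring z ^ p = IsLocalRing.residue _ z := by
    rw [← sub_eq_zero, ← _root_.map_pow, ← _root_.map_sub, hres]
    exact htp
  obtain ⟨n, hn⟩ := (mem_bot_iff_intCast p R).mp
    ((Subfield.mem_bot_iff_pow_eq_self R p).mpr hz)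
  refine ⟨n, ?_⟩
  have : IsLocalRing.residue v.valuationSubring (z - n) = 0 := by
    rw [_root_.map_sub, map_intCast, hn, sub_self]
  simpa [z] using (hres _).mp this

namespace IsEisensteinRoot

variable {K M : Type*} [Field K] [Field M] [Algebra K M]
  {v : Valuation M ℝ≥0} {p : ℕ} {r : ℝ≥0} {q : ℕ → M} {π : M}

theorem map_intCast_lt_one_iff (h : IsEisensteinRoot K v p r q π) (hp : p.Prime) (n : ℤ) :
    v (n : M) < 1 ↔ ((n : ℤ) : ZMod p) = 0 := by
  rw [ZMod.intCast_zmod_eq_zero_iff_dvd]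
  have hn : v (n : M) = v ((n.natAbs : ℕ) : M) := by
    rcases n.natAbs_eq with hn | hn <;> rw [hn] <;> simp [v.map_neg]
  rw [hn]
  constructor
  · intro hlt
    by_contra hdvd
    rw [h.map_natCast_eq_one hp (by rwa [Int.natCast_dvd] at hdvd)] at hlt
    exact lt_irrefl _ hlt
  · intro hdvd
    obtain ⟨k, hk⟩ := Int.natCast_dvd.mp hdvd
    rw [hk, Nat.cast_mul, map_mul]
    exact mul_lt_one_of_nonneg_of_lt_one_left zero_le (h.map_p_lt_one hp) (v.map_natCast_le_one k)

/-- The differences of the `p`-th powers of the inverses of two conjugates are congruent to integer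
multiples of a residual root. -/
theorem exists_map_sub_intCast_mul_lt_one (h : IsEisensteinRoot K v p r q π) (hp : p.Prime)
    (hodd : Odd p) {c : M} (hc : v c = 1) (hres : v (q (p ^ 2) * c ^ p + q p * c) < 1)
    (σ : M ≃ₐ[K] M) : ∃ n : ℤ, v (π⁻¹ ^ p - σ π⁻¹ ^ p - n * c) < 1 := by
  have hc0 : c ≠ 0 := by rintro rfl; simp at hc
  obtain ⟨he1, -, heres⟩ := h.map_sub_le_one hp hodd h.map_inv_root (h.map_equiv_inv_root σ)
    (h.sum_eq_zero σ)
  set e := π⁻¹ ^ p - σ π⁻¹ ^ p with he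
  have ht : v (e / c) ≤ 1 := by rwa [map_div₀, hc, div_one]
  obtain ⟨n, hn⟩ := v.exists_intCast_sub_lt_one hp (h.map_p_lt_one hp) ht (by
    have heq : q p * c * ((e / c) ^ p - e / c) =
        (e / c) ^ p * (q (p ^ 2) * c ^ p + q p * c) - (q (p ^ 2) * e ^ p + q p * e) := by
      have haux (t : M) : q p * c * (t ^ p - t) =
          t ^ p * (q (p ^ 2) * c ^ p + q p * c) - (q (p ^ 2) * (t * c) ^ p + q p * (t * c)) := by
        ring
      rw [haux, div_mul_cancel₀ _ hc0]
    have hlt : v (q p * c * ((e / c) ^ p - e / c)) < 1 := by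
      rw [heq]
      refine v.map_sub_lt ?_ heres
      rw [map_mul, map_pow]
      exact mul_lt_one_of_nonneg_of_lt_one_right (pow_le_one₀ zero_le ht) zero_le hres
    rwa [map_mul, map_mul, h.mid, hc, one_mul, one_mul] at hlt)
  refine ⟨n, ?_⟩
  have : e - n * c = (e / c - n) * c := by field_simp
  rwa [this, map_mul, hc, mul_one]

/-- If the residual polynomial has a nonzero root, then the conjugates of `π` do not form a single
block. -/
theorem exists_map_sub_eq_one [Normal K M] (h : IsEisensteinRoot K v p r q π) (hp : p.Prime)
    (hodd : Odd p) {c : M} (hc : v c = 1)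
    (hres : v (q (p ^ 2) * (c ^ p) ^ p + q p * c ^ p) < 1) :
    ∃ σ : M ≃ₐ[K] M, v (π⁻¹ ^ p - σ π⁻¹ ^ p) = 1 := by
  by_contra! hne
  have hsq := IsReducedCoeffs.two_mul_add_one_le_sq hp hodd
  have hpZ : (0 : ℤ) < p := by exact_mod_cast hp.pos
  have hr0 := h.pos.ne'
  have hrp : r ^ (p : ℤ) < 1 := by rw [← zpow_zero r]; exact h.zpow_lt hpZ
  have hclose (σ : M ≃ₐ[K] M) : v (π⁻¹ - σ π⁻¹) < 1 := by
    have hx := h.map_inv_root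
    have hσ := h.map_equiv_inv_root σ
    have hroot := h.sum_eq_zero σ
    exact (h.map_sub_le_of_lt hp hodd hx hσ hroot (lt_of_le_of_ne
      (h.map_sub_le_one hp hodd hx hσ hroot).1 (hne σ))).trans_lt hrp
  have hpos : (1 : ℝ≥0) < r ^ (-1 : ℤ) := by rw [← zpow_zero r]; exact h.zpow_lt (by norm_num)
  set x := π⁻¹ with hx
  have hvx : v x = r ^ (-1 : ℤ) := h.map_inv_root
  set y := x - c with hy
  have hvy : v y = r ^ (-1 : ℤ) := by
    rw [← hvx]; exact v.map_sub_eq_of_lt_left (by rwa [hvx, hc])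
  have hy0 : y ≠ 0 := by
    rintro h0; rw [h0, map_zero] at hvy; exact zpow_ne_zero _ hr0 hvy.symm
  have hxy : x - y = c := by rw [hy]; ring
  -- the value of the minimal polynomial at `y⁻¹` is small
  have hsmall : v (aeval y⁻¹ (minpoly K π)) < r ^ (2 * (p : ℤ) ^ 2) := by
    have h0 := minpoly.aeval K π
    rw [h.aeval_minpoly π h.root_ne_zero, ← hx] at h0
    have h1 := (mul_eq_zero.mp h0).resolve_left (pow_ne_zero _ h.root_ne_zero)
    have h2 : aeval y⁻¹ (minpoly K π) =
        y⁻¹ ^ (p ^ 2) * p * ∑ i ∈ Finset.Icc 1 (p ^ 2), q i * (y ^ i - x ^ i) := by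
      rw [h.aeval_minpoly _ (inv_ne_zero hy0), inv_inv]
      simp only [mul_sub, Finset.sum_sub_distrib]
      linear_combination y⁻¹ ^ (p ^ 2) * h1
    have hkey := h.map_sum_add_le hp hodd hvx hvy
    have hpow := h.map_pow_sub_sub_pow_le hp hodd hvx hvy
    rw [hxy, hc, mul_one] at hpow hkey
    have hpow' : v (x ^ p - y ^ p - c ^ p) < 1 := by
      refine hpow.trans_lt ?_
      rw [← zpow_zero r]; exact h.zpow_lt (by linarith)
    have hcp : v (c ^ p) ≤ 1 := by rw [map_pow, hc, one_pow]
    have hE := h.map_add_lt_one_of_map_sub_lt_one hp hpow' hcp hres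
    have hEle : v (x ^ p - y ^ p) ≤ 1 := by
      rw [← sub_add_cancel (x ^ p - y ^ p) (c ^ p)]
      exact v.map_add_le hpow'.le hcp
    have hS : v (∑ i ∈ Finset.Icc 1 (p ^ 2), q i * (y ^ i - x ^ i)) < 1 := by
      rw [← add_sub_cancel_right (∑ i ∈ Finset.Icc 1 (p ^ 2), q i * (y ^ i - x ^ i))
        (q (p ^ 2) * (x ^ p - y ^ p) ^ p + q p * (x ^ p - y ^ p))]
      refine v.map_sub_lt (hkey.trans_lt (max_lt ?_ ?_)) hE
      · exact mul_lt_one_of_nonneg_of_lt_one_left zero_le hrp hEle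
      · rw [← zpow_zero r]; exact h.zpow_lt (by linarith)
    rw [h2, map_mul, map_mul, map_pow, map_inv₀, hvy, h.map_p]
    calc _ < (r ^ (-1 : ℤ))⁻¹ ^ (p ^ 2) * r ^ ((p : ℤ) ^ 2) * 1 := by
          refine mul_lt_mul_of_pos_left hS (mul_pos (pow_pos (inv_pos.mpr (zpow_pos h.pos _)) _)
            (zpow_pos h.pos _))
      _ = _ := by
          rw [mul_one, zpow_neg_one, inv_inv, ← zpow_natCast, ← zpow_add₀ hr0]
          congr 1; push_cast; ring
  -- but every factor is large
  have hsplit := Normal.splits (inferInstance : Normal K M) π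
  have hmonic := minpoly.monic h.isIntegral
  rw [hsplit.aeval_eq_prod_aroots_of_monic hmonic, map_multiset_prod, Multiset.map_map] at hsmall
  have hfac : ∀ z ∈ (minpoly K π).aroots M, (⇑v ∘ fun z => y⁻¹ - z) z = r ^ 2 := by
    intro z hz
    obtain ⟨σ, rfl⟩ := minpoly.exists_algEquiv_of_root' h.isIntegral.isAlgebraic
      ((mem_aroots.mp hz).2)
    have hσ0 : σ π ≠ 0 := (map_ne_zero σ).mpr h.root_ne_zero
    have heq : y⁻¹ - σ π = y⁻¹ * σ π * (c - (x - σ x)) := by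
      rw [hx, map_inv₀, ← hx, ← hxy]; field_simp; ring
    change v (y⁻¹ - σ π) = _
    rw [heq, map_mul, map_mul, v.map_sub_eq_of_lt_left (by rw [hc]; exact hclose σ), hc, mul_one,
      map_inv₀, hvy, h.map_equiv, h.map_root, zpow_neg_one, inv_inv, sq]
  rw [Multiset.map_congr rfl hfac, Multiset.map_const', Multiset.prod_replicate,
    ← hsplit.natDegree_eq_card_roots, natDegree_map, h.natDegree, ← pow_mul] at hsmall
  refine hsmall.ne ?_
  rw [← zpow_natCast]; congr 1

/-- A residual root in `K` gives a Galois subextension of `K(π)` of degree `p`. -/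
theorem exists_isGalois [IsGalois K M] [FiniteDimensional K M] (h : IsEisensteinRoot K v p r q π)
    (hp : p.Prime) (hodd : Odd p) {c : K} (hc : v (algebraMap K M c) = 1)
    (hres : v (q (p ^ 2) * (algebraMap K M c ^ p) ^ p + q p * algebraMap K M c ^ p) < 1) :
    ∃ F : IntermediateField K M, F ≤ K⟮π⟯ ∧ IsGalois K F ∧ Module.finrank K F = p := by
  have : Fact p.Prime := ⟨hp⟩
  obtain ⟨σ₀, hσ₀⟩ := h.exists_map_sub_eq_one hp hodd hc hres
  set a := algebraMap K M c ^ p with ha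
  have ha1 : v a = 1 := by rw [ha, map_pow, hc, one_pow]
  have hσa (σ : M ≃ₐ[K] M) : σ a = a := by rw [ha, map_pow, AlgEquiv.commutes]
  choose k hk using h.exists_map_sub_intCast_mul_lt_one hp hodd ha1 hres
  have hiff (σ : M ≃ₐ[K] M) (n : ℤ) :
      v (π⁻¹ ^ p - σ π⁻¹ ^ p - n * a) < 1 ↔ ((k σ : ℤ) : ZMod p) = n := by
    rw [← sub_eq_zero, ← Int.cast_sub, ← h.map_intCast_lt_one_iff hp]
    have hmul : v ((k σ - n : ℤ) : M) = v (((k σ - n : ℤ) : M) * a) := by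
      rw [map_mul, ha1, mul_one]
    rw [hmul]
    constructor
    · intro hn
      convert v.map_sub_lt hn (hk σ) using 2
      push_cast; ring
    · intro hn
      convert v.map_add_lt hn (hk σ) using 2
      push_cast; ring
  let χ : (M ≃ₐ[K] M) →* Multiplicative (ZMod p) := MonoidHom.mk'
    (fun σ => Multiplicative.ofAdd ((k σ : ℤ) : ZMod p)) fun σ τ => by
      rw [← ofAdd_add, ← Int.cast_add]
      congr 1
      rw [← hiff]
      have hτ := hk τ
      rw [← h.map_equiv σ] at hτ
      convert v.map_add_lt (hk σ) hτ using 2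
      rw [map_sub, map_sub, map_mul, hσa, map_intCast, map_pow, map_pow, AlgEquiv.mul_apply]
      push_cast; ring
  have hχ (σ : M ≃ₐ[K] M) : σ ∈ χ.ker ↔ v (π⁻¹ ^ p - σ π⁻¹ ^ p) < 1 := by
    have := hiff σ 0
    rw [Int.cast_zero, zero_mul, sub_zero, Int.cast_zero] at this
    rw [this]
    exact Iff.rfl
  have hindex : χ.ker.index = p := by
    rw [Subgroup.index_ker]
    have hdvd := Subgroup.card_subgroup_dvd_card χ.range
    rw [Nat.card_eq_fintype_card (α := Multiplicative (ZMod p)), Fintype.card_multiplicative,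
      ZMod.card] at hdvd
    refine ((Nat.dvd_prime hp).mp hdvd).resolve_left fun h1 => ?_
    have hbot := Subgroup.card_eq_one.mp h1
    have : χ σ₀ = 1 := by
      rw [← Subgroup.mem_bot, ← hbot]; exact ⟨σ₀, rfl⟩
    exact ((hχ σ₀).mp this).ne hσ₀
  refine ⟨fixedField χ.ker, ?_, inferInstance, ?_⟩
  · rw [← IsGalois.fixedField_fixingSubgroup K⟮π⟯]
    refine fixedField_antitone fun σ hσ => ?_
    have hσπ : σ π = π := hσ ⟨π, mem_adjoin_simple_self K π⟩
    rw [hχ, map_inv₀, hσπ, sub_self, map_zero]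
    exact one_pos
  · rw [finrank_eq_fixingSubgroup_index, fixingSubgroup_fixedField, hindex]

end IsEisensteinRoot

section Construction

variable {K M : Type*} [Field K] [Field M] [Algebra K M]

/-- The value of `X ^ N + p * (q 1 * X ^ (N - 1) + ⋯ + q N)` at a nonzero element. -/
theorem aeval_monic_sum_eq {N p : ℕ} {F q : ℕ → K} (hF : ∀ i, 1 ≤ i → i ≤ N → F i = p * q i)
    {θ : M} (hθ : θ ≠ 0) :
    aeval θ (X ^ N + ∑ i ∈ Finset.range N, C (F (i + 1)) * X ^ (N - (i + 1))) =
      θ ^ N * (1 + p * ∑ i ∈ Finset.Icc 1 N, algebraMap K M (q i) * θ⁻¹ ^ i) := by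
  have hIcc : Finset.Icc 1 N = Finset.Ico 1 (N + 1) := by ext; simp
  rw [hIcc, Finset.sum_Ico_eq_sum_range, Nat.add_sub_cancel, mul_add, mul_one, Finset.mul_sum,
    Finset.mul_sum, map_add, map_sum, map_pow, aeval_X]
  congr 1
  refine Finset.sum_congr rfl fun i hi => ?_
  have hi' := Finset.mem_range.mp hi
  rw [map_mul, aeval_C, map_pow, aeval_X, hF _ (by omega) (by omega), map_mul, map_natCast,
    add_comm 1 i]
  have : θ ^ N = θ ^ (N - (i + 1)) * θ ^ (i + 1) := by rw [← pow_add]; congr 1; omega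
  rw [this, inv_pow]
  field_simp

theorem monic_X_pow_add_sum (N : ℕ) (F : ℕ → K) :
    (X ^ N + ∑ i ∈ Finset.range N, C (F (i + 1)) * X ^ (N - (i + 1))).Monic ∧
      (X ^ N + ∑ i ∈ Finset.range N, C (F (i + 1)) * X ^ (N - (i + 1))).natDegree = N := by
  have hdeg : (∑ i ∈ Finset.range N, C (F (i + 1)) * X ^ (N - (i + 1))).degree < (N : WithBot ℕ) := by
    refine (degree_sum_le _ _).trans_lt ?_
    rw [Finset.sup_lt_iff (WithBot.bot_lt_coe _)]
    intro i hi
    refine (degree_C_mul_X_pow_le _ _).trans_lt ?_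
    have := Finset.mem_range.mp hi
    exact_mod_cast (by omega : N - (i + 1) < N)
  exact ⟨monic_X_pow_add hdeg, by
    rw [natDegree_add_eq_left_of_degree_lt (by rwa [degree_X_pow]), natDegree_X_pow]⟩

/-- The value of a root of an Eisenstein polynomial. -/
theorem Valuation.map_eisenstein_root (v : Valuation M ℝ≥0) {N p : ℕ} (hN : 0 < N)
    (hp0 : v (p : M) ≠ 0) (hp1 : v (p : M) < 1) {F q : ℕ → K}
    (hF : ∀ i, 1 ≤ i → i ≤ N → F i = p * q i)
    (hq : ∀ i, 1 ≤ i → i ≤ N → v (algebraMap K M (q i)) ≤ 1)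
    (hqN : v (algebraMap K M (q N)) = 1) {π : M}
    (hπ : aeval π (X ^ N + ∑ i ∈ Finset.range N, C (F (i + 1)) * X ^ (N - (i + 1))) = 0) :
    v π ^ N = v (p : M) ∧ v π < 1 ∧ 0 < v π := by
  obtain ⟨n, rfl⟩ : ∃ n, N = n + 1 := ⟨N - 1, by omega⟩
  have hroot : π ^ (n + 1) = - ∑ i ∈ Finset.range (n + 1),
      p * algebraMap K M (q (i + 1)) * π ^ (n - i) := by
    rw [map_add, map_sum, map_pow, aeval_X] at hπ
    rw [eq_neg_iff_add_eq_zero, ← hπ]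
    congr 1
    refine Finset.sum_congr rfl fun i hi => ?_
    have := Finset.mem_range.mp hi
    rw [map_mul, aeval_C, map_pow, aeval_X, hF _ (by omega) (by omega), map_mul, map_natCast]
    congr 2; omega
  have hle (i : ℕ) (hi : i < n + 1) : v (p * algebraMap K M (q (i + 1)) * π ^ (n - i)) ≤
      v (p : M) * v π ^ (n - i) := by
    rw [map_mul, map_mul, map_pow]
    gcongr
    exact mul_le_of_le_one_right zero_le (hq _ (by omega) (by omega))
  have hlt1 : v π < 1 := by
    by_contra! hge
    have hpos : 0 < v π := one_pos.trans_le hge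
    have : v (π ^ (n + 1)) < v (π ^ (n + 1)) := by
      conv_lhs => rw [hroot]
      rw [v.map_neg]
      refine v.map_sum_lt (by rw [map_pow]; exact (pow_pos hpos _).ne') fun i hi => ?_
      refine (hle i (Finset.mem_range.mp hi)).trans_lt ?_
      rw [map_pow]
      calc _ < 1 * v π ^ (n - i) := mul_lt_mul_of_pos_right hp1 (pow_pos hpos _)
        _ ≤ _ := by rw [one_mul]; exact pow_le_pow_right₀ hge (by omega)
    exact lt_irrefl _ this
  have hval : v π ^ (n + 1) = v (p : M) := by
    rw [← map_pow, hroot, v.map_neg, Finset.sum_range_succ]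
    have hlast : v (p * algebraMap K M (q (n + 1)) * π ^ (n - n)) = v (p : M) := by
      rw [Nat.sub_self, pow_zero, mul_one, map_mul, hqN, mul_one]
    rw [v.map_add_eq_of_lt_right, hlast]
    rw [hlast]
    refine v.map_sum_lt hp0 fun i hi => ?_
    have hi' := Finset.mem_range.mp hi
    refine (hle i (by omega)).trans_lt ?_
    exact mul_lt_of_lt_one_right (pos_iff_ne_zero.mpr hp0) (pow_lt_one₀ zero_le hlt1 (by omega))
  refine ⟨hval, hlt1, pos_iff_ne_zero.mpr fun h0 => hp0 ?_⟩
  rw [← hval, h0, zero_pow (by omega)]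

/-- Data over an absolutely unramified field `K` giving rise to an `IsEisensteinRoot`. -/
theorem IsEisensteinRoot.of_aeval_eq_zero {v : Valuation M ℝ≥0} {p : ℕ} (hp : p.Prime)
    (hp0 : v (p : M) ≠ 0) (hp1 : v (p : M) < 1) {F q : ℕ → K}
    (hF : ∀ i, 1 ≤ i → i ≤ p ^ 2 → F i = p * q i)
    (hq : ∀ i, 1 ≤ i → i ≤ p ^ 2 → v (algebraMap K M (q i)) ≤ 1)
    (htop : v (algebraMap K M (q (p ^ 2))) = 1) (hmid : v (algebraMap K M (q p)) = 1)
    (hlow : ∀ i, 1 ≤ i → i < p ^ 2 → i ≠ p → v (algebraMap K M (q i)) ≤ v (p : M))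
    (hhigh : ∀ i, ¬ p ∣ i → p + 2 ≤ i → i < p ^ 2 → v (algebraMap K M (q i)) ≤ v (p : M) ^ 2)
    (hbase : ∀ c : K, c ≠ 0 → ∃ n : ℤ, v (algebraMap K M c) = v (p : M) ^ n)
    (hequiv : ∀ (σ : M ≃ₐ[K] M) (m : M), v (σ m) = v m) {π : M}
    (hπ : aeval π (X ^ p ^ 2 + ∑ i ∈ Finset.range (p ^ 2),
      C (F (i + 1)) * X ^ (p ^ 2 - (i + 1))) = 0) :
    IsEisensteinRoot K v p (v π) (fun i => algebraMap K M (q i)) π := by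
  have hp2 := hp.two_le
  have hpp : p + 1 < p ^ 2 := by nlinarith
  obtain ⟨hval, hlt1, hpos⟩ := v.map_eisenstein_root (pow_pos hp.pos 2) hp0 hp1 hF hq htop hπ
  have hvp : v (p : M) = v π ^ ((p : ℤ) ^ 2) := by rw [← hval]; norm_cast
  have hbase' (c : K) (hc : c ≠ 0) :
      ∃ n : ℤ, v (algebraMap K M c) = v π ^ ((p : ℤ) ^ 2 * n) := by
    obtain ⟨n, hn⟩ := hbase c hc
    exact ⟨n, by rw [hn, hvp, zpow_mul]⟩
  obtain ⟨hmonic, hdeg⟩ := monic_X_pow_add_sum (p ^ 2) F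
  set P := X ^ p ^ 2 + ∑ i ∈ Finset.range (p ^ 2), C (F (i + 1)) * X ^ (p ^ 2 - (i + 1)) with hP
  have hInt : IsIntegral K π := ⟨P, hmonic, hπ⟩
  have hge : p ^ 2 ≤ (minpoly K π).natDegree := by
    by_contra! hlt
    have h0 := minpoly.aeval K π
    rw [aeval_eq_sum_range' hlt] at h0
    simp only [Algebra.smul_def] at h0
    obtain ⟨i, -, hi, hmax⟩ := v.exists_map_sum_eq hpos hlt1 (pow_pos hp.pos 2) rfl
      (by simpa using hbase') (minpoly K π).coeff
    rw [h0, map_zero] at hi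
    have hlead := hmax _ hlt
    rw [← hi, ← leadingCoeff, (minpoly.monic hInt).leadingCoeff, map_one, one_mul, map_pow] at hlead
    exact absurd hlead (not_le.mpr (pow_pos hpos _))
  have hPmin : P = minpoly K π :=
    eq_of_monic_of_dvd_of_natDegree_le (minpoly.monic hInt) hmonic (minpoly.dvd K π hπ)
      (by rw [hdeg]; exact hge)
  exact
    { pos := hpos
      lt_one := hlt1
      map_p := hvp
      top := htop
      mid := hmid
      mult := fun k hk1 hk2 => by
        rw [← hvp]
        refine hlow _ (by nlinarith) (by nlinarith) ?_
        intro h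
        nlinarith
      low := fun i hi1 hi2 => by
        rw [← hvp]
        refine hlow _ (Nat.one_le_iff_ne_zero.mpr ?_) (by omega) ?_
        · rintro rfl; exact hi1 (dvd_zero p)
        · rintro rfl; exact hi1 dvd_rfl
      high := fun i hi1 hi2 hi3 => by
        refine (hhigh i hi1 hi2 hi3).trans_eq ?_
        rw [hvp, ← zpow_natCast, ← zpow_mul]
        congr 1; push_cast; ring
      map_root := rfl
      map_base := hbase'
      map_equiv := hequiv
      isIntegral := hInt
      natDegree := by rw [← hPmin, hdeg]
      aeval_minpoly := fun θ hθ => by rw [← hPmin, hP, aeval_monic_sum_eq hF hθ] }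

end Construction

section BaseRing

variable {O K : Type*} [CommRing O] [Field K] [Algebra O K]
  {w : Valuation K ℝ≥0} {p : ℕ}

theorem Valuation.map_algebraMap_unit (hw : ∀ x : O, w (algebraMap O K x) ≤ 1) {u : O}
    (hu : IsUnit u) : w (algebraMap O K u) = 1 := by
  obtain ⟨u, rfl⟩ := hu
  refine le_antisymm (hw _) ?_
  have h : w (algebraMap O K u) * w (algebraMap O K ↑u⁻¹) = 1 := by
    rw [← map_mul, ← map_mul, Units.mul_inv, map_one, map_one]
  rw [← h]
  exact mul_le_of_le_one_right zero_le (hw _)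

/-- A nonzero element of a ring with maximal ideal `(p)` is a power of `p` times a unit. -/
theorem exists_eq_natCast_pow_mul_unit [IsFractionRing O K] (hloc : ∀ x : O, ¬ IsUnit x → (p : O) ∣ x)
    (hw : ∀ x : O, w (algebraMap O K x) ≤ 1) (hp1 : w (p : K) < 1) {x : O} (hx : x ≠ 0) :
    ∃ (n : ℕ) (u : O), IsUnit u ∧ x = p ^ n * u := by
  have hfin : FiniteMultiplicity (p : O) x := by
    have hpos : 0 < w (algebraMap O K x) :=
      pos_iff_ne_zero.mpr <| w.ne_zero_iff.mpr <|
        (map_ne_zero_iff _ (IsFractionRing.injective O K)).mpr hx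
    obtain ⟨n, hn⟩ := exists_pow_lt_of_lt_one hpos hp1
    refine ⟨n, fun ⟨y, hy⟩ => ?_⟩
    rw [hy, map_mul, map_mul, map_pow, map_pow, map_natCast (algebraMap O K)] at hn
    refine (not_le.mpr hn) ?_
    calc _ ≤ w (p : K) ^ (n + 1) := mul_le_of_le_one_right zero_le (hw y)
      _ ≤ _ := pow_le_pow_of_le_one zero_le hp1.le (Nat.le_succ n)
  obtain ⟨u, hu, hpu⟩ := hfin.exists_eq_pow_mul_and_not_dvd
  exact ⟨_, u, not_not.mp fun h => hpu (hloc u h), hu⟩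

theorem exists_eq_natCast_zpow_mul_unit [IsDomain O] [IsFractionRing O K]
    (hloc : ∀ x : O, ¬ IsUnit x → (p : O) ∣ x)
    (hw : ∀ x : O, w (algebraMap O K x) ≤ 1) (hp0 : w (p : K) ≠ 0) (hp1 : w (p : K) < 1)
    {k : K} (hk : k ≠ 0) :
    ∃ (n : ℤ) (u : O), IsUnit u ∧ k = (p : K) ^ n * algebraMap O K u := by
  obtain ⟨x, y, hy, rfl⟩ := IsFractionRing.div_surjective (A := O) k
  have hx : x ≠ 0 := by rintro rfl; simp at hk
  obtain ⟨m, u, hu, rfl⟩ := exists_eq_natCast_pow_mul_unit hloc hw hp1 hx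
  obtain ⟨n, t, ht, rfl⟩ :=
    exists_eq_natCast_pow_mul_unit hloc hw hp1 (nonZeroDivisors.ne_zero hy)
  have hpK : (p : K) ≠ 0 := w.ne_zero_iff.mp hp0
  obtain ⟨t, rfl⟩ := ht
  refine ⟨m - n, u * ↑t⁻¹, hu.mul t⁻¹.isUnit, ?_⟩
  have h : algebraMap O K t * algebraMap O K ↑t⁻¹ = 1 := by rw [← map_mul, Units.mul_inv, map_one]
  have ht0 : algebraMap O K t ≠ 0 := left_ne_zero_of_mul_eq_one h
  simp only [map_mul, map_pow, map_natCast]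
  rw [zpow_sub₀ hpK, zpow_natCast, zpow_natCast, eq_inv_of_mul_eq_one_right h]
  field_simp

theorem exists_map_eq_zpow [IsDomain O] [IsFractionRing O K]
    (hloc : ∀ x : O, ¬ IsUnit x → (p : O) ∣ x)
    (hw : ∀ x : O, w (algebraMap O K x) ≤ 1) (hp0 : w (p : K) ≠ 0) (hp1 : w (p : K) < 1)
    {k : K} (hk : k ≠ 0) : ∃ n : ℤ, w k = w (p : K) ^ n := by
  obtain ⟨n, u, hu, rfl⟩ := exists_eq_natCast_zpow_mul_unit hloc hw hp0 hp1 hk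
  exact ⟨n, by rw [map_mul, map_zpow₀, w.map_algebraMap_unit hw hu, mul_one]⟩

theorem exists_algebraMap_eq_of_map_eq_one [IsDomain O] [IsFractionRing O K]
    (hloc : ∀ x : O, ¬ IsUnit x → (p : O) ∣ x)
    (hw : ∀ x : O, w (algebraMap O K x) ≤ 1) (hp0 : w (p : K) ≠ 0) (hp1 : w (p : K) < 1)
    {k : K} (hk : w k = 1) : ∃ u : O, IsUnit u ∧ algebraMap O K u = k := by
  have hk0 : k ≠ 0 := by rintro rfl; simp at hk
  obtain ⟨n, u, hu, rfl⟩ := exists_eq_natCast_zpow_mul_unit hloc hw hp0 hp1 hk0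
  rw [map_mul, map_zpow₀, w.map_algebraMap_unit hw hu, mul_one,
    zpow_eq_one_iff_right₀ zero_le hp1.ne] at hk
  exact ⟨u, hu, by rw [hk, zpow_zero, one_mul]⟩

theorem map_lt_one_iff_natCast_dvd (hloc : ∀ x : O, ¬ IsUnit x → (p : O) ∣ x)
    (hw : ∀ x : O, w (algebraMap O K x) ≤ 1) (hp1 : w (p : K) < 1) (x : O) :
    w (algebraMap O K x) < 1 ↔ (p : O) ∣ x := by
  refine ⟨fun h => hloc x fun hu => h.ne (w.map_algebraMap_unit hw hu), ?_⟩
  rintro ⟨y, rfl⟩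
  rw [map_mul, map_mul, map_natCast]
  exact (mul_le_of_le_one_right zero_le (hw y)).trans_lt hp1

end BaseRing

/-- The extension of the `p`-adic absolute value to an algebraic extension of `ℚ_[p]`. -/
theorem Padic.exists_valuation_extension (p : ℕ) [Fact p.Prime] (M : Type*) [Field M]
    [Algebra ℚ_[p] M] [Algebra.IsAlgebraic ℚ_[p] M] :
    ∃ v : Valuation M ℝ≥0, (∀ z : ℚ_[p], v (algebraMap ℚ_[p] M z) = ‖z‖₊) ∧
      ∀ (σ : M ≃ₐ[ℚ_[p]] M) (m : M), v (σ m) = v m := by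
  refine ⟨{ toFun := fun m => ⟨spectralNorm ℚ_[p] M m, spectralNorm_nonneg m⟩
            map_zero' := ?_
            map_one' := ?_
            map_mul' := fun x y => ?_
            map_add_le_max' := fun x y => ?_ }, fun z => ?_, fun σ m => ?_⟩
  · exact NNReal.eq spectralNorm_zero
  · exact NNReal.eq spectralNorm_one
  · exact NNReal.eq (map_mul (spectralMulAlgNorm ℚ_[p] M) x y)
  · exact isNonarchimedean_spectralNorm x y
  · exact NNReal.eq (spectralNorm_extends z)
  · exact NNReal.eq (spectralNorm_eq_of_equiv σ m).symm

theorem Valuation.map_le_one_of_isIntegral {A K : Type*} [CommRing A] [Field K] [Algebra A K]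
    (w : Valuation K ℝ≥0) (hw : ∀ x : A, w (algebraMap A K x) ≤ 1) {k : K} (hk : IsIntegral A k) :
    w k ≤ 1 := by
  obtain ⟨P, hP, hPk⟩ := hk
  by_contra! h
  have hpos : 0 < w k := one_pos.trans h
  rw [← aeval_def, aeval_eq_sum_range, Finset.sum_range_succ, hP.coeff_natDegree, one_smul,
    add_eq_zero_iff_neg_eq] at hPk
  have : w (k ^ P.natDegree) < w (k ^ P.natDegree) := by
    conv_lhs => rw [← hPk, w.map_neg]
    refine w.map_sum_lt (by rw [_root_.map_pow]; exact (pow_pos hpos _).ne') fun i hi => ?_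
    rw [Algebra.smul_def, _root_.map_mul, _root_.map_pow, _root_.map_pow]
    exact (mul_le_of_le_one_left zero_le (hw _)).trans_lt
      (pow_lt_pow_right₀ h (Finset.mem_range.mp hi))
  exact lt_irrefl _ this

theorem isFractionRing_integralClosure (p : ℕ) [Fact p.Prime] (K : Type) [Field K]
    [Algebra ℚ_[p] K] [FiniteDimensional ℚ_[p] K] :
    IsFractionRing (integralClosure ℤ_[p] K) K :=
  @integralClosure.isFractionRing_of_finite_extension ℤ_[p] ℚ_[p] _ K _ _ PadicInt.algebra _ _ _ _
    (@IsScalarTower.of_algebraMap_eq ℤ_[p] ℚ_[p] K _ _ _ PadicInt.algebra _ _ fun _ => rfl) _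

/-- The finite extension generated by a root, embedded in its normal closure, with an invariant
valuation extending the `p`-adic one. -/
theorem exists_isGalois_valuation (p : ℕ) [Fact p.Prime] (K : Type) [Field K]
    [Algebra ℚ_[p] K] [FiniteDimensional ℚ_[p] K] (L : Type) [Field L] [Algebra K L]
    [FiniteDimensional K L] :
    ∃ (M : Type) (_ : Field M) (_ : Algebra K M) (_ : FiniteDimensional K M) (_ : IsGalois K M)
      (_ : L →ₐ[K] M) (v : Valuation M ℝ≥0),
      (∀ z : ℚ_[p], v (algebraMap K M (algebraMap ℚ_[p] K z)) = ‖z‖₊) ∧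
      ∀ (σ : M ≃ₐ[K] M) (m : M), v (σ m) = v m := by
  have : CharZero K := charZero_of_injective_algebraMap (algebraMap ℚ_[p] K).injective
  let : Algebra K (AlgebraicClosure L) := inferInstance
  have hac : IsAlgClosure K (AlgebraicClosure L) :=
    ⟨inferInstance, Algebra.IsAlgebraic.trans K L (AlgebraicClosure L)⟩
  have : Normal K (AlgebraicClosure L) := IsAlgClosure.normal K _
  let M := normalClosure K L (AlgebraicClosure L)
  have : Normal K M := inferInstance
  have : IsGalois K M := { }
  let : Algebra ℚ_[p] M := ((algebraMap K M).comp (algebraMap ℚ_[p] K)).toAlgebra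
  have : IsScalarTower ℚ_[p] K M := IsScalarTower.of_algebraMap_eq fun _ => rfl
  have : FiniteDimensional ℚ_[p] M := FiniteDimensional.trans ℚ_[p] K M
  obtain ⟨v, hv, hv'⟩ := Padic.exists_valuation_extension p M
  exact ⟨M, inferInstance, inferInstance, inferInstance, inferInstance,
    IsScalarTower.toAlgHom K L M, v, hv, fun σ m => hv' (σ.restrictScalars ℚ_[p]) m⟩

/-- Subextensions of `K⟮ι π⟯` and of `L = K⟮π⟯` correspond to each other. -/
theorem exists_isGalois_of_le_adjoin {K L M : Type*} [Field K] [Field L] [Field M] [Algebra K L]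
    [Algebra K M] (ι : L →ₐ[K] M) {π : L} (hgen : adjoin K {π} = ⊤) {F : IntermediateField K M}
    (hF : F ≤ K⟮ι π⟯) [IsGalois K F] :
    ∃ F' : IntermediateField K L, IsGalois K F' ∧ Module.finrank K F' = Module.finrank K F := by
  have hmap : (F.comap ι).map ι = F := by
    have hrange : K⟮ι π⟯ = ι.fieldRange := by
      rw [← Set.image_singleton, ← adjoin_map, hgen, AlgHom.fieldRange_eq_map]
    refine le_antisymm ?_ fun x hx => ?_
    · rintro _ ⟨y, hy, rfl⟩
      exact hy
    · obtain ⟨y, rfl⟩ := hrange ▸ hF hx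
      exact ⟨y, hx, rfl⟩
  let e : F ≃ₐ[K] F.comap ι :=
    (IntermediateField.equivOfEq hmap.symm).trans ((F.comap ι).equivMap ι).symm
  exact ⟨F.comap ι, IsGalois.of_algEquiv e, e.toLinearEquiv.finrank_eq.symm⟩

theorem map_mem_adjoin_of_adjoin_eq_top {K L M : Type*} [Field K] [Field L] [Field M] [Algebra K L]
    [Algebra K M] (ι : L →ₐ[K] M) {π : L} (hgen : adjoin K {π} = ⊤) (y : L) : ι y ∈ K⟮ι π⟯ := by
  have hy : y ∈ K⟮π⟯ := by rw [hgen]; exact mem_top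
  have h : ι y ∈ K⟮π⟯.map ι := ⟨y, hy, rfl⟩
  rwa [adjoin_map, Set.image_singleton] at h

section Residue

variable {O K M κ : Type*} [CommRing O] [IsDomain O] [Field K] [Algebra O K] [IsFractionRing O K]
  [Field M] [Algebra K M] [Field κ] {v : Valuation M ℝ≥0} {p : ℕ}

/-- An Eisenstein polynomial over `O` satisfying the conditions on its ramification polygon
yields an `IsEisensteinRoot`. -/
theorem IsEisensteinRoot.of_dvd (hp : p.Prime) (hloc : ∀ x : O, ¬ IsUnit x → (p : O) ∣ x)
    (hw : ∀ x : O, v (algebraMap K M (algebraMap O K x)) ≤ 1)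
    (hp0 : v (p : M) ≠ 0) (hp1 : v (p : M) < 1)
    (hequiv : ∀ (σ : M ≃ₐ[K] M) (m : M), v (σ m) = v m) {f : ℕ → O}
    (hf : ∀ i, 1 ≤ i → i ≤ p ^ 2 → (p : O) ∣ f i) (hmid : ¬ (p : O) ^ 2 ∣ f p)
    (htop : ¬ (p : O) ^ 2 ∣ f (p ^ 2))
    (hlow : ∀ i, 1 ≤ i → i < p ^ 2 → i ≠ p → (p : O) ^ 2 ∣ f i)
    (hhigh : ∀ i, p + 2 ≤ i → i ≤ p ^ 2 - 1 → Nat.Coprime i p → (p : O) ^ 3 ∣ f i) {π : M}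
    (hπ : aeval π (X ^ p ^ 2 + ∑ i ∈ Finset.range (p ^ 2),
      C (algebraMap O K (f (i + 1))) * X ^ (p ^ 2 - (i + 1))) = 0) :
    IsEisensteinRoot K v p (v π) (fun i => algebraMap K M (algebraMap O K (f i) / p)) π := by
  have hpM : (p : M) ≠ 0 := v.ne_zero_iff.mp hp0
  have hpK : (p : K) ≠ 0 := fun h => hpM (by rw [← map_natCast (algebraMap K M), h, map_zero])
  have hquot (i : ℕ) (y : O) (h : f i = p * y) :
      algebraMap O K (f i) / p = algebraMap O K y := by
    rw [h, map_mul, map_natCast, mul_div_cancel_left₀ _ hpK]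
  let w : Valuation K ℝ≥0 := v.comap (algebraMap K M)
  have hwp : w (p : K) = v (p : M) := by
    rw [← map_natCast (algebraMap K M)]
    rfl
  have hunit (i : ℕ) (hi1 : 1 ≤ i) (hi2 : i ≤ p ^ 2) (h : ¬ (p : O) ^ 2 ∣ f i) :
      v (algebraMap K M (algebraMap O K (f i) / p)) = 1 := by
    obtain ⟨y, hy⟩ := hf i hi1 hi2
    rw [hquot i y hy]
    refine w.map_algebraMap_unit hw (not_not.mp fun hu => h ?_)
    rw [hy, pow_two]
    exact mul_dvd_mul_left _ (hloc y hu)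
  have hdvd (i n : ℕ) (h : (p : O) ^ (n + 1) ∣ f i) :
      v (algebraMap K M (algebraMap O K (f i) / p)) ≤ v (p : M) ^ n := by
    obtain ⟨y, hy⟩ := h
    rw [pow_succ', mul_assoc] at hy
    rw [hquot i _ hy, map_mul, map_pow, map_natCast, map_mul, map_pow, map_natCast, map_mul,
      map_pow]
    exact mul_le_of_le_one_right zero_le (hw y)
  have hpp : p ≤ p ^ 2 := Nat.le_self_pow two_ne_zero p
  refine IsEisensteinRoot.of_aeval_eq_zero hp hp0 hp1 (F := fun i => algebraMap O K (f i))
    (q := fun i => algebraMap O K (f i) / p) (fun i _ _ => (mul_div_cancel₀ _ hpK).symm)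
    (fun i hi1 hi2 => ?_) (hunit _ (Nat.one_le_pow _ _ hp.pos) le_rfl htop)
    (hunit _ hp.pos hpp hmid) (fun i hi1 hi2 hi3 => ?_) (fun i hi1 hi2 hi3 => ?_)
    (fun c hc => ?_) hequiv hπ
  · simpa using hdvd i 0 (by simpa using hf i hi1 hi2)
  · simpa using hdvd i 1 (hlow i hi1 hi2 hi3)
  · exact hdvd i 2 (hhigh i hi2 (by omega) ((hp.coprime_iff_not_dvd.mpr hi1).symm))
  · rw [← hwp]
    exact exists_map_eq_zpow (w := w) hloc hw (by rwa [hwp]) (by rwa [hwp]) hc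

omit [IsDomain O] [IsFractionRing O K] in
theorem valuation_lt_one_iff_residue_eq_zero (hloc : ∀ x : O, ¬ IsUnit x → (p : O) ∣ x)
    (hw : ∀ x : O, v (algebraMap K M (algebraMap O K x)) ≤ 1) (hp1 : v (p : M) < 1)
    {ρ : O →+* κ} (hker : RingHom.ker ρ = Ideal.span {(p : O)}) (x : O) :
    v (algebraMap K M (algebraMap O K x)) < 1 ↔ ρ x = 0 := by
  have hwp : v.comap (algebraMap K M) (p : K) < 1 := by
    rwa [Valuation.comap_apply, map_natCast]
  rw [← RingHom.mem_ker, hker, Ideal.mem_span_singleton]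
  exact map_lt_one_iff_natCast_dvd (w := v.comap (algebraMap K M)) hloc hw hwp x

theorem pow_sub_one_eq_neg_div_iff {α β c : κ} (hp : 0 < p) (hβ : β ≠ 0) (hc : c ≠ 0) :
    c ^ (p - 1) = -α / β ↔ β * c ^ p + α * c = 0 := by
  obtain ⟨n, rfl⟩ : ∃ n, p = n + 1 := ⟨p - 1, by omega⟩
  rw [eq_div_iff hβ, eq_neg_iff_add_eq_zero, Nat.add_sub_cancel]
  have : β * c ^ (n + 1) + α * c = (c ^ n * β + α) * c := by ring
  rw [this, mul_eq_zero, or_iff_left hc]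

end Residue

/-- Let `f` be an Eisenstein polynomial of degree `p²` over a finite
unramified extension `K/ℚ_p` (`p` odd) satisfying the valuation conditions (R1) and (R2), and
let `L = K(π)` for a root `π` of `f`.  Then `L` contains a Galois extension of `K` of degree `p`
if and only if `−F_p/F_{p²} ∈ (κ_K^×)^{p−1}`, where `F_p = (f_p/p)‾`, `F_{p²} = (f_{p²}/p)‾`. -/
theorem stmt11 (p : ℕ) [Fact (Nat.Prime p)] (hodd : Odd p)
    (K : Type) [Field K] [Algebra ℚ_[p] K] [FiniteDimensional ℚ_[p] K]
    (hKloc : ∀ x : integralClosure ℤ_[p] K, ¬IsUnit x → (p : integralClosure ℤ_[p] K) ∣ x)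
    (hKp : ¬IsUnit (p : integralClosure ℤ_[p] K))
    -- the residue field
    (κ : Type) [Field κ] [Finite κ] [CharP κ p]
    (ρ : integralClosure ℤ_[p] K →+* κ) (hρ : Function.Surjective ρ)
    (hker : RingHom.ker ρ = Ideal.span {(p : integralClosure ℤ_[p] K)})
    -- an Eisenstein polynomial of degree `p²`
    (f : ℕ → integralClosure ℤ_[p] K)
    (hfE : ∀ i, 1 ≤ i → i ≤ p ^ 2 → (p : integralClosure ℤ_[p] K) ∣ f i)
    (hfE' : ¬(p : integralClosure ℤ_[p] K) ^ 2 ∣ f (p ^ 2))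
    -- witnesses for `F_p = ρ a`, `F_{p²} = ρ b`, `G_i = ρ (g i)`
    (a b : integralClosure ℤ_[p] K) (g : ℕ → integralClosure ℤ_[p] K)
    (ha : f p = p * a) (hb : f (p ^ 2) = p * b)
    (hg : ∀ i, 1 ≤ i → i < p ^ 2 → i ≠ p → f i = p ^ 2 * g i)
    -- (R1)  v_p(f_p) = 1 and v_p(f_{pi}) ≥ 2 for i ∈ 𝕀(2,p−1)
    (hR1a : ¬(p : integralClosure ℤ_[p] K) ^ 2 ∣ f p)
    (hR1b : ∀ i, 2 ≤ i → i ≤ p - 1 → Nat.Coprime i p →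
      (p : integralClosure ℤ_[p] K) ^ 2 ∣ f (p * i))
    -- (R2)  v_p(f_i) ≥ 2 for i ∈ 𝕀(1,p−1), v_p(f_{p+1}) = 2, v_p(f_i) ≥ 3 for i ∈ 𝕀(p+2,p²−1)
    (hR2a : ∀ i, 1 ≤ i → i ≤ p - 1 → Nat.Coprime i p →
      (p : integralClosure ℤ_[p] K) ^ 2 ∣ f i)
    (hR2b : ¬(p : integralClosure ℤ_[p] K) ^ 3 ∣ f (p + 1))
    (hR2c : ∀ i, p + 2 ≤ i → i ≤ p ^ 2 - 1 → Nat.Coprime i p →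
      (p : integralClosure ℤ_[p] K) ^ 3 ∣ f i)
    -- the extension `L = K(π)` generated by a root of `f`
    (L : Type) [Field L] [Algebra K L] (π : L)
    (hπ : aeval π (X ^ p ^ 2 + ∑ i ∈ Finset.range (p ^ 2),
        C ((f (i + 1) : K)) * X ^ (p ^ 2 - (i + 1))) = 0)
    (hgen : adjoin K {π} = ⊤) :
    (∃ F : IntermediateField K L, IsGalois K F ∧ Module.finrank K F = p) ↔
      ∃ c : κ, c ≠ 0 ∧ c ^ (p - 1) = -ρ a / ρ b := by
  have hp : p.Prime := Fact.out
  have hfr : IsFractionRing (integralClosure ℤ_[p] K) K := isFractionRing_integralClosure p K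
  obtain ⟨hmonic, -⟩ := monic_X_pow_add_sum (p ^ 2) (fun i => (f i : K))
  have hfin : FiniteDimensional K L := by
    have hInt : IsIntegral K π := ⟨_, hmonic, hπ⟩
    have := IntermediateField.adjoin.finiteDimensional hInt
    rw [hgen] at this
    exact (topEquiv (F := K) (E := L)).toLinearEquiv.finiteDimensional
  obtain ⟨M, _, _, _, _, ι, v, hv, hequiv⟩ := exists_isGalois_valuation p K L
  have hw (x : integralClosure ℤ_[p] K) :
      v (algebraMap K M (algebraMap (integralClosure ℤ_[p] K) K x)) ≤ 1 := by
    refine (v.comap (algebraMap K M)).map_le_one_of_isIntegral (A := ℤ_[p]) (fun z => ?_) x.2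
    exact (hv z).trans_le (PadicInt.norm_le_one z)
  have hvp : v (p : M) = ‖(p : ℚ_[p])‖₊ := by
    rw [← hv, map_natCast (algebraMap ℚ_[p] K), map_natCast (algebraMap K M)]
  have hp0 : v (p : M) ≠ 0 := by
    rw [hvp, nnnorm_ne_zero_iff]
    exact_mod_cast hp.ne_zero
  have hp1 : v (p : M) < 1 := by
    rw [hvp]
    exact Padic.norm_p_lt_one
  have hroot : aeval (ι π) (X ^ p ^ 2 + ∑ i ∈ Finset.range (p ^ 2),
      C (algebraMap (integralClosure ℤ_[p] K) K (f (i + 1))) * X ^ (p ^ 2 - (i + 1))) = 0 := by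
    rw [aeval_algHom_apply]
    exact (congrArg ι hπ).trans (map_zero ι)
  have h := IsEisensteinRoot.of_dvd hp hKloc hw hp0 hp1 hequiv hfE hR1a hfE'
    (fun i h1 h2 h3 => ⟨g i, hg i h1 h2 h3⟩) hR2c hroot
  have hpK : (p : K) ≠ 0 := fun h0 => v.ne_zero_iff.mp hp0 <| by
    rw [← map_natCast (algebraMap K M), h0, map_zero]
  have hA : algebraMap (integralClosure ℤ_[p] K) K (f p) / p = algebraMap _ K a := by
    rw [ha, map_mul, map_natCast, mul_div_cancel_left₀ _ hpK]
  have hB : algebraMap (integralClosure ℤ_[p] K) K (f (p ^ 2)) / p = algebraMap _ K b := by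
    rw [hb, map_mul, map_natCast, mul_div_cancel_left₀ _ hpK]
  have hres := valuation_lt_one_iff_residue_eq_zero (v := v) hKloc hw hp1 hker
  have hρb : ρ b ≠ 0 := by
    intro h0
    rw [← RingHom.mem_ker, hker, Ideal.mem_span_singleton] at h0
    refine hfE' ?_
    rw [hb, pow_two]
    exact mul_dvd_mul_left _ h0
  constructor
  · rintro ⟨F, hFG, hF⟩
    obtain ⟨c, hc, hlt⟩ := h.exists_residual_root hp hodd hF (ι.comp F.val)
      (fun y => map_mem_adjoin_of_adjoin_eq_top ι hgen y) rfl rfl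
    obtain ⟨u, -, rfl⟩ := exists_algebraMap_eq_of_map_eq_one (w := v.comap (algebraMap K M))
      (p := p) hKloc hw (by rwa [Valuation.comap_apply, map_natCast])
      (by rwa [Valuation.comap_apply, map_natCast]) hc
    have hu : ρ u ≠ 0 := fun h0 => hc.not_lt ((hres u).mpr h0)
    refine ⟨ρ u, hu, (pow_sub_one_eq_neg_div_iff hp.pos hρb hu).mpr ?_⟩
    rw [hA, hB] at hlt
    rw [← map_pow, ← map_mul, ← map_mul, ← map_add, ← hres]
    simpa only [map_add, map_mul, map_pow] using hlt
  · rintro ⟨c, hc0, hc⟩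
    obtain ⟨d, rfl⟩ : ∃ d, d ^ p = c :=
      (Finite.injective_iff_surjective.mp (frobenius_inj κ p)) c
    obtain ⟨u, rfl⟩ := hρ d
    have hu : v (algebraMap K M (algebraMap _ K u)) = 1 :=
      (hw u).antisymm (not_lt.mp fun hlt => hc0 (by
        rw [(hres u).mp hlt, zero_pow hp.ne_zero]))
    rw [pow_sub_one_eq_neg_div_iff hp.pos hρb hc0, ← map_pow, ← map_pow, ← map_mul, ← map_mul,
      ← map_add, ← hres] at hc
    obtain ⟨F, hF, hFG, hFp⟩ := h.exists_isGalois hp hodd hu (by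
      simpa only [hA, hB, map_add, map_mul, map_pow] using hc)
    obtain ⟨F', hF'⟩ := exists_isGalois_of_le_adjoin ι hgen hF
    exact ⟨F', hF'.1, hF'.2.trans hFp⟩
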